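/- (Theorem 4.1) Let k > 0 and let φ : ℝ² → ℂ be a bounded measurable function with compact support. Let w be a function on the closed half-space {x = (x₁,x₂,x₃) ∈ ℝ³ : x₃ ≤ 0}, continuous on the closed half-space and twice continuously differentiable on the open half-space {x₃ < 0}, satisfying: (i) the Helmholtz equation Δw(x) + k² w(x) = 0 for all x with x₃ < 0; (ii) the boundary condition w(x₁, x₂, 0) = φ(x₁, x₂) for all (x₁, x₂) ∈ ℝ²; (iii) the Sommerfeld radiation condition: r·(∂w/∂r(x) − i k w(x)) → 0 as r = |x| → ∞, uniformly over directions x/|x| in the half-space x₃ ≤ 0, where ∂w/∂r(x) = (x/|x|) · ∇w(x). Then for every x₃ < 0 and every Schwartz function ψ : ℝ² → ℂ, the function (x₁,x₂) ↦ w(x₁, x₂, x₃) Ψ(x₁, x₂) is integrable on ℝ² and ∫_{ℝ²} w(x₁, x₂, x₃) Ψ(x₁, x₂) dx₁ dx₂ = ∫_{ℝ²} φ̂(v₁, v₂) e^{−i κ(v₁,v₂) x₃} ψ(v₁, v₂) dv₁ dv₂; that is, the tempered-distribution Fourier transform of w with respect to (x₁, x₂) satisfies ŵ(v₁, v₂,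 x₃) = φ̂(v₁, v₂) e^{−i κ(v₁,v₂) x₃} for all x₃ < 0. -/

import Mathlib

open MeasureTheory

noncomputable section

/-- The point `(x₁, x₂, x₃)` of Euclidean 3-space. -/
def pt3 (x₁ x₂ x₃ : ℝ) : EuclideanSpace ℝ (Fin 3) :=
  (WithLp.equiv 2 (Fin 3 → ℝ)).symm ![x₁, x₂, x₃]

/-- The Laplacian `Δw = ∂²w/∂x₁² + ∂²w/∂x₂² + ∂²w/∂x₃²` of `w : ℝ³ → ℂ`. -/
def lap3 (w : EuclideanSpace ℝ (Fin 3) → ℂ) (x : EuclideanSpace ℝ (Fin 3)) : ℂ :=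
  ∑ i : Fin 3,
    fderiv ℝ (fun y => fderiv ℝ w y (EuclideanSpace.single i 1)) x (EuclideanSpace.single i 1)

/-- `κ(v) = √(k² − |v|²)` for `|v|² ≤ k²` and `κ(v) = i √(|v|² − k²)` for `|v|² > k²`. -/
def kappa (k : ℝ) (v : ℝ × ℝ) : ℂ :=
  if v.1 ^ 2 + v.2 ^ 2 ≤ k ^ 2 then (Real.sqrt (k ^ 2 - v.1 ^ 2 - v.2 ^ 2) : ℂ)
  else Complex.I * (Real.sqrt (v.1 ^ 2 + v.2 ^ 2 - k ^ 2) : ℂ)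

/-- The Fourier transform (with kernel `e^{-ix·v}`) of an integrable function `φ` on ℝ². -/
def fourierT (φ : ℝ × ℝ → ℂ) (v : ℝ × ℝ) : ℂ :=
  ∫ x : ℝ × ℝ, φ x * Complex.exp (-Complex.I * ((x.1 * v.1 + x.2 * v.2 : ℝ) : ℂ))

/-- `Ψ(x) = ∫ ψ(v) e^{-i x·v} dv`, the (kernel `e^{-ix·v}`) Fourier transform of the
Schwartz function `ψ`. -/
def BigPsi (ψ : SchwartzMap (ℝ × ℝ) ℂ) (x : ℝ × ℝ) : ℂ :=
  ∫ v : ℝ × ℝ, ψ v * Complex.exp (-Complex.I * ((x.1 * v.1 + x.2 * v.2 : ℝ) : ℂ))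

section Part1

open MeasureTheory



abbrev E3 := EuclideanSpace ℝ (Fin 3)

/-- coordinate derivative -/
def dd (i : Fin 3) (v : E3 → ℂ) (y : E3) : ℂ := fderiv ℝ v y (EuclideanSpace.single i 1)

lemma lap3_eq (v : E3 → ℂ) (y : E3) : lap3 v y = ∑ i, dd i (dd i v) y := rfl

lemma dd_congr {i : Fin 3} {a b : E3 → ℂ} {y : E3} (h : a =ᶠ[nhds y] b) : dd i a y = dd i b y := by
  unfold dd; rw [h.fderiv_eq]

lemma dd_congr_ev {i : Fin 3} {a b : E3 → ℂ} {y : E3} (h : a =ᶠ[nhds y] b) :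
    dd i a =ᶠ[nhds y] dd i b := by
  filter_upwards [h.eventually_nhds] with z hz
  exact dd_congr hz

lemma lap3_congr {a b : E3 → ℂ} {y : E3} (h : a =ᶠ[nhds y] b) : lap3 a y = lap3 b y := by
  rw [lap3_eq, lap3_eq]
  exact Finset.sum_congr rfl fun i _ => dd_congr (dd_congr_ev h)

lemma cd2_ev_diff {a : E3 → ℂ} {y : E3} (h : ContDiffAt ℝ 2 a y) :
    ∀ᶠ z in nhds y, DifferentiableAt ℝ a z := by
  filter_upwards [h.eventually (by simp)] with z hz
  exact hz.differentiableAt (by simp)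

lemma cd2_dd {a : E3 → ℂ} {y : E3} (h : ContDiffAt ℝ 2 a y) (i : Fin 3) :
    ContDiffAt ℝ 1 (dd i a) y := by
  unfold dd
  have := h.fderiv_right (m := 1) (by norm_num)
  exact this.clm_apply contDiffAt_const

lemma cd1_dd {a : E3 → ℂ} {y : E3} (h : ContDiffAt ℝ 1 a y) (i : Fin 3) :
    ContDiffAt ℝ 0 (dd i a) y := by
  unfold dd
  have := h.fderiv_right (m := 0) (by norm_num)
  exact this.clm_apply contDiffAt_const

lemma dd_mul {a b : E3 → ℂ} {y : E3} (ha : DifferentiableAt ℝ a y) (hb : DifferentiableAt ℝ b y)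
    (i : Fin 3) : dd i (fun z => a z * b z) y = a y * dd i b y + b y * dd i a y := by
  unfold dd
  rw [fderiv_fun_mul ha hb]; simp

lemma dd_add {a b : E3 → ℂ} {y : E3} (ha : DifferentiableAt ℝ a y) (hb : DifferentiableAt ℝ b y)
    (i : Fin 3) : dd i (fun z => a z + b z) y = dd i a y + dd i b y := by
  unfold dd
  rw [fderiv_fun_add ha hb]; simp

lemma dd_sub {a b : E3 → ℂ} {y : E3} (ha : DifferentiableAt ℝ a y) (hb : DifferentiableAt ℝ b y)
    (i : Fin 3) : dd i (fun z => a z - b z) y = dd i a y - dd i b y := by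
  unfold dd
  rw [fderiv_fun_sub ha hb]; simp

lemma lap3_sub {a b : E3 → ℂ} {y : E3} (ha : ContDiffAt ℝ 2 a y) (hb : ContDiffAt ℝ 2 b y) :
    lap3 (fun z => a z - b z) y = lap3 a y - lap3 b y := by
  simp only [lap3_eq, ← Finset.sum_sub_distrib]
  refine Finset.sum_congr rfl fun i _ => ?_
  rw [dd_congr (b := fun z => dd i a z - dd i b z), dd_sub]
  · exact (cd2_dd ha i).differentiableAt (by simp)
  · exact (cd2_dd hb i).differentiableAt (by simp)
  · filter_upwards [cd2_ev_diff ha, cd2_ev_diff hb] with z h1 h2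
    exact dd_sub h1 h2 i

lemma lap3_mul {a b : E3 → ℂ} {y : E3} (ha : ContDiffAt ℝ 2 a y) (hb : ContDiffAt ℝ 2 b y) :
    lap3 (fun z => a z * b z) y
      = a y * lap3 b y + 2 * (∑ i, dd i a y * dd i b y) + b y * lap3 a y := by
  simp only [lap3_eq, Finset.mul_sum, ← Finset.sum_add_distrib]
  refine Finset.sum_congr rfl fun i _ => ?_
  have ha0 := ha.differentiableAt (by simp)
  have hb0 := hb.differentiableAt (by simp)
  have ha1 := (cd2_dd ha i).differentiableAt (by simp)
  have hb1 := (cd2_dd hb i).differentiableAt (by simp)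
  rw [dd_congr (b := fun z => a z * dd i b z + b z * dd i a z), dd_add (ha0.fun_mul hb1) (hb0.fun_mul ha1),
    dd_mul ha0 hb1, dd_mul hb0 ha1]
  · ring
  · filter_upwards [cd2_ev_diff ha, cd2_ev_diff hb] with z h1 h2
    exact dd_mul h1 h2 i

lemma hasFDerivAt_dist {a y : E3} (h : y ≠ a) :
    HasFDerivAt (fun z : E3 => ‖z - a‖) (‖y - a‖⁻¹ • innerSL ℝ (y - a)) y := by
  have h0 : y - a ≠ 0 := sub_ne_zero.2 h
  have h1 : HasFDerivAt (fun z : E3 => ‖z - a‖ ^ 2) (2 • innerSL ℝ (y - a)) y := by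
    simpa using ((hasFDerivAt_id y).sub_const a).norm_sq
  have h2 := h1.sqrt (by positivity)
  simp only [Real.sqrt_sq (norm_nonneg _)] at h2
  have h3 : ‖y - a‖ ≠ 0 := norm_ne_zero_iff.2 h0
  have e : (1 / (2 * ‖y - a‖)) • (2 • innerSL ℝ (y - a) : E3 →L[ℝ] ℝ)
      = ‖y - a‖⁻¹ • innerSL ℝ (y - a) := by
    rw [← Nat.cast_smul_eq_nsmul ℝ, smul_smul]
    congr 1
    push_cast
    field_simp
  exact e ▸ h2

lemma radial_fderiv {g : ℝ → ℂ} {g' : ℂ} {a y : E3} (h : y ≠ a)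
    (hg : HasDerivAt g g' ‖y - a‖) (e : E3) :
    fderiv ℝ (fun z : E3 => g ‖z - a‖) y e = g' * ((inner ℝ (y - a) e / ‖y - a‖ : ℝ) : ℂ) := by
  have := hg.hasFDerivAt.comp y (hasFDerivAt_dist h)
  have h2 : fderiv ℝ (fun z : E3 => g ‖z - a‖) y = _ := this.fderiv
  rw [h2]
  simp [div_eq_inv_mul, inner_sub_left]
  ring

lemma radial_dd {g : ℝ → ℂ} {g' : ℂ} {a y : E3} (h : y ≠ a)
    (hg : HasDerivAt g g' ‖y - a‖) (i : Fin 3) :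
    dd i (fun z : E3 => g ‖z - a‖) y = g' * (((y i - a i) / ‖y - a‖ : ℝ) : ℂ) := by
  unfold dd
  rw [radial_fderiv h hg]
  simp [EuclideanSpace.inner_single_right]

lemma sum_sq_eq (z : E3) : ∑ i, (z i) ^ 2 = ‖z‖ ^ 2 := by
  rw [EuclideanSpace.norm_sq_eq]; simp

lemma radial_lap3 {g g1 : ℝ → ℂ} {g2 : ℂ} {a y : E3} (h : y ≠ a)
    (hg : ∀ᶠ t in nhds ‖y - a‖, HasDerivAt g (g1 t) t) (hg1 : HasDerivAt g1 g2 ‖y - a‖) :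
    lap3 (fun z : E3 => g ‖z - a‖) y = g2 + 2 * g1 ‖y - a‖ / (‖y - a‖ : ℂ) := by
  have h0 : 0 < ‖y - a‖ := norm_pos_iff.2 (sub_ne_zero.2 h)
  have h0c : ((‖y - a‖ : ℝ) : ℂ) ≠ 0 := by exact_mod_cast h0.ne'
  have hm : HasDerivAt (fun t : ℝ => g1 t / (t : ℂ))
      ((g2 * ‖y - a‖ - g1 ‖y - a‖ * 1) / (‖y - a‖ : ℂ) ^ 2) ‖y - a‖ := by
    exact hg1.div (HasDerivAt.ofReal_comp (hasDerivAt_id _)) h0c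
  have key : ∀ i, dd i (dd i (fun z : E3 => g ‖z - a‖)) y =
      ((g2 * ‖y - a‖ - g1 ‖y - a‖ * 1) / (‖y - a‖ : ℂ) ^ 2 / ‖y - a‖) * (((y - a) i) ^ 2 : ℝ)
        + g1 ‖y - a‖ / (‖y - a‖ : ℂ) := by
    intro i
    have ev : dd i (fun z : E3 => g ‖z - a‖) =ᶠ[nhds y]
        fun z => (g1 ‖z - a‖ / (‖z - a‖ : ℂ)) * ((z i - a i : ℝ) : ℂ) := by
      have hc : Filter.Tendsto (fun z : E3 => ‖z - a‖) (nhds y) (nhds ‖y - a‖) := by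
        apply Continuous.tendsto; fun_prop
      filter_upwards [hc.eventually hg, isOpen_ne.mem_nhds h] with z hz hza
      rw [radial_dd hza hz]; push_cast; ring
    have hl : HasFDerivAt (fun z : E3 => ((z i - a i : ℝ) : ℂ))
        (Complex.ofRealCLM.comp (EuclideanSpace.proj (𝕜 := ℝ) i : E3 →L[ℝ] ℝ)) y :=
      Complex.ofRealCLM.hasFDerivAt.comp y
        (((EuclideanSpace.proj (𝕜 := ℝ) i : E3 →L[ℝ] ℝ).hasFDerivAt).sub_const _)
    have hm' : DifferentiableAt ℝ (fun z : E3 => g1 ‖z - a‖ / (‖z - a‖ : ℂ)) y :=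
      DifferentiableAt.comp (g := fun t : ℝ => g1 t / (t : ℂ)) y hm.differentiableAt
        (hasFDerivAt_dist h).differentiableAt
    rw [dd_congr ev, dd_mul hm' hl.differentiableAt, radial_dd h hm]
    have : dd i (fun z : E3 => ((z i - a i : ℝ) : ℂ)) y = 1 := by
      unfold dd; rw [hl.fderiv]; simp
    rw [this]
    simp
    field_simp
    ring
  rw [lap3_eq, Finset.sum_congr rfl fun i _ => key i, Finset.sum_add_distrib, ← Finset.mul_sum,
    ← Complex.ofReal_sum, sum_sq_eq]
  simp
  field_simp
  ring

end Part1

section Part2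

open MeasureTheory



lemma pt3_apply0 (a b c : ℝ) : pt3 a b c 0 = a := rfl
lemma pt3_apply1 (a b c : ℝ) : pt3 a b c 1 = b := rfl
lemma pt3_apply2 (a b c : ℝ) : pt3 a b c 2 = c := rfl

lemma continuous_pt3 : Continuous fun q : ℝ × ℝ × ℝ => pt3 q.1 q.2.1 q.2.2 := by
  unfold pt3
  refine (PiLp.continuous_toLp 2 _).comp ?_
  refine continuous_pi fun i => ?_
  fin_cases i <;> simp <;> fun_prop

lemma abs_coord_le (y : E3) (i : Fin 3) : |y i| ≤ ‖y‖ := by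
  simpa using PiLp.norm_apply_le y i

lemma dd_zero_of_far {v : E3 → ℂ} {L : ℝ} (hL : ∀ y, L < ‖y‖ → v y = 0) (i : Fin 3) :
    ∀ y, L < ‖y‖ → dd i v y = 0 := by
  intro y hy
  have : v =ᶠ[nhds y] fun _ => 0 := by
    filter_upwards [(isOpen_lt continuous_const continuous_norm).mem_nhds hy] with z hz
    exact hL z hz
  rw [dd_congr this]; simp [dd]

lemma lap3_zero_of_far {v : E3 → ℂ} {L : ℝ} (hL : ∀ y, L < ‖y‖ → v y = 0) :
    ∀ y, L < ‖y‖ → lap3 v y = 0 := by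
  intro y hy
  rw [lap3_eq]
  exact Finset.sum_eq_zero fun i _ => dd_zero_of_far (dd_zero_of_far hL i) i y hy

lemma volume_plane : volume {y : E3 | y 2 = 0} = 0 := by
  have h := (PiLp.volume_preserving_ofLp (Fin 3))
  have h2 : volume {x : Fin 3 → ℝ | x 2 = 0} = 0 := by
    rw [volume_pi]; exact Measure.pi_hyperplane (fun _ : Fin 3 => (volume : Measure ℝ)) 2 0
  rw [← h.measure_preimage] at h2
  · exact h2
  · exact (measurableSet_eq_fun (by fun_prop) (by fun_prop)).nullMeasurableSet

lemma half_ae : {y : E3 | y 2 < 0} =ᵐ[volume] {y : E3 | y 2 ≤ 0} := by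
  have : ∀ᵐ y : E3, y 2 ≠ 0 := by
    rw [ae_iff]; simpa using volume_plane
  filter_upwards [this] with y hy
  apply propext
  change y 2 < 0 ↔ y 2 ≤ 0
  exact ⟨le_of_lt, fun h => lt_of_le_of_ne h hy⟩

lemma continuous_lap3 {v : E3 → ℂ} (hv : ContDiff ℝ 2 v) : Continuous (lap3 v) := by
  have : lap3 v = fun y => ∑ i, dd i (dd i v) y := by ext y; exact lap3_eq v y
  rw [this]
  refine continuous_finsetSum _ fun i _ => ?_
  have h1 : ContDiff ℝ 1 (dd i v) := contDiff_iff_contDiffAt.2 fun y => cd2_dd hv.contDiffAt i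
  have h2 : ContDiff ℝ 0 (dd i (dd i v)) :=
    contDiff_iff_contDiffAt.2 fun y => cd1_dd h1.contDiffAt i
  exact h2.continuous

lemma continuous_dd {v : E3 → ℂ} (hv : ContDiff ℝ 2 v) (i : Fin 3) : Continuous (dd i v) := by
  have h1 : ContDiff ℝ 1 (dd i v) := contDiff_iff_contDiffAt.2 fun y => cd2_dd hv.contDiffAt i
  exact h1.continuous

theorem green_shift (κ : ℂ) {δ : ℝ} (hδ : 0 < δ) {w v : E3 → ℂ}
    (hw : ∀ x : E3, x 2 < δ → ContDiffAt ℝ 2 w x)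
    (hH : ∀ x : E3, x 2 < δ → lap3 w x + κ ^ 2 * w x = 0)
    (hv : ContDiff ℝ 2 v) {L : ℝ} (hL : ∀ y, L < ‖y‖ → v y = 0)
    (hv0 : ∀ y : E3, y 2 = 0 → v y = 0) :
    ∫ y in {y : E3 | y 2 < 0}, w y * (lap3 v y + κ ^ 2 * v y)
      = ∫ p : ℝ × ℝ, w (pt3 p.1 p.2 0) * dd 2 v (pt3 p.1 p.2 0) := by
  set B : ℝ := |L| + 1 with hB
  have hBL : L < B := by have := le_abs_self L; linarith
  have hB0 : 0 < B := by positivity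
  let a : Fin 3 → ℝ := ![-B, -B, -B]
  let b : Fin 3 → ℝ := ![B, B, 0]
  have hab : a ≤ b := by
    intro i; fin_cases i <;> simp [a, b] <;> linarith
  let F : Fin 3 → E3 → ℂ := fun i y => w y * dd i v y - v y * dd i w y
  have hF : ∀ i (y : E3), y 2 < δ → ContDiffAt ℝ 1 (F i) y := by
    intro i y hy
    exact (((hw y hy).of_le (by norm_num)).mul (cd2_dd hv.contDiffAt i)).sub
      ((hv.contDiffAt.of_le (by norm_num)).mul (cd2_dd (hw y hy) i))
  let T : (Fin 3 → ℝ) ≃L[ℝ] E3 := (PiLp.continuousLinearEquiv 2 ℝ (fun _ : Fin 3 => ℝ)).symm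
  have hT : ∀ x, T x = WithLp.toLp 2 x := fun x => rfl
  have hT2 : ∀ x i, (T x) i = x i := fun x i => rfl
  have hTs : ∀ i, T (Pi.single i 1) = EuclideanSpace.single i 1 := fun i => rfl
  have hdiv : ∀ y : E3, y 2 < δ → ∑ i, dd i (F i) y = w y * (lap3 v y + κ ^ 2 * v y) := by
    intro y hy
    have e : ∀ i, dd i (F i) y = w y * dd i (dd i v) y - v y * dd i (dd i w) y := by
      intro i
      have w0 := (hw y hy).differentiableAt (by simp)
      have v0 := hv.contDiffAt.differentiableAt (x := y) (by simp)
      have w1 := (cd2_dd (hw y hy) i).differentiableAt (by simp)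
      have v1 := (cd2_dd (hv.contDiffAt (x := y)) i).differentiableAt (by simp)
      change dd i (fun y => w y * dd i v y - v y * dd i w y) y = _
      rw [dd_sub (w0.fun_mul v1) (v0.fun_mul w1), dd_mul w0 v1, dd_mul v0 w1]
      ring
    simp only [e, Finset.sum_sub_distrib, ← Finset.mul_sum, ← lap3_eq]
    linear_combination (v y) * (-1) * hH y hy
  have hbox : ∀ x ∈ Set.Icc a b, (T x) 2 < δ := by
    intro x hx
    have := hx.2 2
    simp [b] at this
    rw [hT2]; linarith
  have key := integral_divergence_of_hasFDerivAt_off_countable' a b hab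
    (fun i x => F i (T x)) (fun i x => (fderiv ℝ (F i) (T x)).comp (T : (Fin 3 → ℝ) →L[ℝ] E3))
    ∅ Set.countable_empty
    (fun i x hx => (((hF i _ (hbox x hx)).continuousAt).comp
      T.continuous.continuousAt).continuousWithinAt)
    (fun x hx i => by
      have hx' : x ∈ Set.Icc a b := by
        refine ⟨fun i => ?_, fun i => ?_⟩
        · exact (hx.1 i (Set.mem_univ _)).1.le
        · exact (hx.1 i (Set.mem_univ _)).2.le
      exact (((hF i _ (hbox x hx')).differentiableAt (by simp)).hasFDerivAt).comp x
        T.hasFDerivAt)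
    (by
      have hc : ContinuousOn (fun x => w (T x) * (lap3 v (T x) + κ ^ 2 * v (T x)))
          (Set.Icc a b) := by
        intro x hx
        have c1 : ContinuousAt (fun x => w (T x)) x :=
          ContinuousAt.comp (hw _ (hbox x hx)).continuousAt T.continuous.continuousAt
        have c2 : Continuous (fun x => lap3 v (T x) + κ ^ 2 * v (T x)) := by
          have := continuous_lap3 hv
          have := hv.continuous
          have := T.continuous
          fun_prop
        exact (c1.mul c2.continuousAt).continuousWithinAt
      refine (hc.integrableOn_compact isCompact_Icc).congr_fun ?_ measurableSet_Icc
      intro x hx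
      exact (hdiv _ (hbox x hx)).symm)
  have far : ∀ y : E3, (∃ i, |y i| = B) → ∀ j, F j y = 0 := by
    rintro y ⟨i, hi⟩ j
    have : L < ‖y‖ := by have := abs_coord_le y i; linarith
    simp only [F, hL y this, dd_zero_of_far hL j y this]; ring
  have lhs : (∫ x in Set.Icc a b, ∑ i, ((fderiv ℝ (F i) (T x)).comp
        (T : (Fin 3 → ℝ) →L[ℝ] E3)) (Pi.single i 1))
      = ∫ y in {y : E3 | y 2 < 0}, w y * (lap3 v y + κ ^ 2 * v y) := by
    rw [setIntegral_congr_set half_ae]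
    rw [← (PiLp.volume_preserving_toLp (Fin 3)).setIntegral_preimage_emb
      (MeasurableEquiv.toLp 2 (Fin 3 → ℝ)).measurableEmbedding]
    have hs : Set.Icc a b ⊆ (WithLp.toLp 2 : (Fin 3 → ℝ) → E3) ⁻¹' {y : E3 | y 2 ≤ 0} := by
      intro x hx
      have := hx.2 2
      simpa [b] using this
    rw [setIntegral_eq_of_subset_of_forall_sdiff_eq_zero ?_ hs]
    · refine setIntegral_congr_fun measurableSet_Icc fun x hx => ?_
      exact hdiv _ (hbox x hx)
    · rintro x ⟨hx1, hx2⟩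
      have hx1' : x 2 ≤ 0 := hx1
      have : L < ‖(WithLp.toLp 2 x : E3)‖ := by
        by_contra hcon
        push Not at hcon
        apply hx2
        have hh : ∀ i, |x i| ≤ B := fun i =>
          (abs_coord_le (WithLp.toLp 2 x : E3) i).trans (by linarith)
        have h0 := abs_le.1 (hh 0)
        have h1 := abs_le.1 (hh 1)
        have h2 := abs_le.1 (hh 2)
        refine ⟨fun i => ?_, fun i => ?_⟩ <;> fin_cases i <;> simp [a, b] <;> linarith
      simp [hL _ this, lap3_zero_of_far hL _ this]
    · exact measurableSet_le (measurable_pi_apply 2) measurable_const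
  rw [← lhs, key, Fin.sum_univ_three]
  have z : ∀ (i : Fin 3) (c : ℝ), |c| = B → 
      (∫ x in Set.Icc (a ∘ i.succAbove) (b ∘ i.succAbove), F i (T (i.insertNth c x))) = 0 := by
    intro i c hc
    refine setIntegral_eq_zero_of_forall_eq_zero fun x _ => far _ ⟨i, ?_⟩ i
    rw [hT2]; simpa using hc
  have z0 := z 0 (b 0) (by simp [b, abs_of_pos hB0])
  have z0' := z 0 (a 0) (by simp [a, abs_of_pos hB0])
  have z1 := z 1 (b 1) (by simp [b, abs_of_pos hB0])
  have z1' := z 1 (a 1) (by simp [a, abs_of_pos hB0])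
  have z2' := z 2 (a 2) (by simp [a, abs_of_pos hB0])
  rw [z0, z0', z1, z1', z2']
  simp only [sub_zero, zero_add]
  have ins : ∀ x : Fin 2 → ℝ, T ((2 : Fin 3).insertNth (b 2) x) = pt3 (x 0) (x 1) 0 := by
    intro x
    ext i
    fin_cases i <;> rfl
  have hFt : ∀ x : Fin 2 → ℝ, F 2 (T ((2 : Fin 3).insertNth (b 2) x))
      = w (pt3 (x 0) (x 1) 0) * dd 2 v (pt3 (x 0) (x 1) 0) := by
    intro x
    rw [ins]
    simp only [F, hv0 _ (pt3_apply2 (x 0) (x 1) 0)]; ring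
  simp only [hFt]
  rw [setIntegral_eq_integral_of_forall_compl_eq_zero]
  · have := (volume_preserving_finTwoArrow ℝ).integral_comp
      (MeasurableEquiv.finTwoArrow (α := ℝ)).measurableEmbedding
      (fun p : ℝ × ℝ => w (pt3 p.1 p.2 0) * dd 2 v (pt3 p.1 p.2 0))
    rw [← this]
    rfl
  · intro x hx
    have : L < ‖pt3 (x 0) (x 1) 0‖ := by
      by_contra hcon
      push Not at hcon
      apply hx
      have hh : ∀ i, |pt3 (x 0) (x 1) 0 i| ≤ B := fun i =>
        (abs_coord_le _ i).trans (by linarith)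
      have h0 := abs_le.1 (hh 0)
      have h1 := abs_le.1 (hh 1)
      rw [pt3_apply0] at h0
      rw [pt3_apply1] at h1
      refine ⟨fun i => ?_, fun i => ?_⟩ <;> fin_cases i
      · exact h0.1
      · exact h1.1
      · exact h0.2
      · exact h1.2
    rw [dd_zero_of_far hL 2 _ this, mul_zero]

end Part2

section Part3

open MeasureTheory Filter Topology



lemma dd_shift (w : E3 → ℂ) (c : E3) (i : Fin 3) :
    dd i (fun z => w (z + c)) = fun z => dd i w (z + c) := by
  ext y; unfold dd; rw [fderiv_comp_add_right]

lemma lap3_shift (w : E3 → ℂ) (c : E3) (y : E3) :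
    lap3 (fun z => w (z + c)) y = lap3 w (y + c) := by
  rw [lap3_eq, lap3_eq]
  refine Finset.sum_congr rfl fun i _ => ?_
  rw [dd_shift, dd_shift]

lemma isClosed_half : IsClosed {x : E3 | x 2 ≤ 0} :=
  isClosed_le (by fun_prop) continuous_const

lemma isOpen_half : IsOpen {x : E3 | x 2 < 0} :=
  isOpen_lt (by fun_prop) continuous_const

lemma half_bound {w : E3 → ℂ} (hw : ContinuousOn w {x : E3 | x 2 ≤ 0}) (L : ℝ) :
    ∃ M : ℝ, 0 ≤ M ∧ ∀ y : E3, y 2 ≤ 0 → ‖y‖ ≤ L → ‖w y‖ ≤ M := by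
  have hc : IsCompact (Metric.closedBall (0 : E3) L ∩ {x : E3 | x 2 ≤ 0}) :=
    (isCompact_closedBall _ _).inter_right isClosed_half
  obtain ⟨M, hM⟩ := hc.exists_bound_of_continuousOn (hw.mono Set.inter_subset_right)
  refine ⟨max M 0, le_max_right _ _, fun y h1 h2 => (hM y ⟨by simpa using h2, h1⟩).trans
    (le_max_left _ _)⟩

theorem green (κ : ℂ) {w v : E3 → ℂ}
    (hwc : ContinuousOn w {x : E3 | x 2 ≤ 0})
    (hw : ContDiffOn ℝ 2 w {x : E3 | x 2 < 0})
    (hH : ∀ x : E3, x 2 < 0 → lap3 w x + κ ^ 2 * w x = 0)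
    (hv : ContDiff ℝ 2 v) {L : ℝ} (hL : ∀ y, L < ‖y‖ → v y = 0)
    (hv0 : ∀ y : E3, y 2 = 0 → v y = 0) :
    ∫ y in {y : E3 | y 2 < 0}, w y * (lap3 v y + κ ^ 2 * v y)
      = ∫ p : ℝ × ℝ, w (pt3 p.1 p.2 0) * dd 2 v (pt3 p.1 p.2 0) := by
  let δ : ℕ → ℝ := fun n => 1 / ((n : ℝ) + 1)
  have hδ0 : ∀ n, 0 < δ n := fun n => by positivity
  have hδ1 : ∀ n, δ n ≤ 1 := fun n => by
    simp only [δ]; rw [div_le_one (by positivity)]; have : (0:ℝ) ≤ n := by positivity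
    linarith
  have hδt : Tendsto δ atTop (𝓝 0) := tendsto_one_div_add_atTop_nhds_zero_nat
  let e : E3 := EuclideanSpace.single 2 1
  have he : ‖e‖ = 1 := by simp [e]
  have hc2 : ∀ n (y : E3), (y + (-δ n) • e) 2 = y 2 - δ n := by
    intro n y; simp [e]; ring
  let D : E3 → ℂ := fun y => lap3 v y + κ ^ 2 * v y
  have hDc : Continuous D := (continuous_lap3 hv).add (continuous_const.mul hv.continuous)
  have hD0 : ∀ y, L < ‖y‖ → D y = 0 := by
    intro y hy; simp [D, hL y hy, lap3_zero_of_far hL y hy]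
  have hsupp : ∀ {f : E3 → ℂ}, (∀ y, L < ‖y‖ → f y = 0) → HasCompactSupport f := by
    intro f hf
    refine HasCompactSupport.intro (isCompact_closedBall (0 : E3) L) fun y hy => hf y ?_
    simpa using hy
  have hDi : Integrable D := hDc.integrable_of_hasCompactSupport (hsupp hD0)
  obtain ⟨M, hM0, hM⟩ := half_bound hwc (L + 1)
  have hg : ∀ n, ∫ y in {y : E3 | y 2 < 0}, w (y + (-δ n) • e) * D y
      = ∫ p : ℝ × ℝ, w (pt3 p.1 p.2 0 + (-δ n) • e) * dd 2 v (pt3 p.1 p.2 0) := by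
    intro n
    refine green_shift κ (hδ0 n) (w := fun y => w (y + (-δ n) • e)) ?_ ?_ hv hL hv0
    · intro x hx
      have hx' : (x + (-δ n) • e) 2 < 0 := by rw [hc2]; linarith
      have := hw.contDiffAt (isOpen_half.mem_nhds hx')
      exact ContDiffAt.comp x this (contDiffAt_id.add contDiffAt_const)
    · intro x hx
      have hx' : (x + (-δ n) • e) 2 < 0 := by rw [hc2]; linarith
      rw [lap3_shift]; exact hH _ hx'
  have hwt : ∀ y : E3, y 2 ≤ 0 → Tendsto (fun n => w (y + (-δ n) • e)) atTop (𝓝 (w y)) := by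
    intro y hy
    have h1 : Tendsto (fun n => y + (-δ n) • e) atTop (𝓝[{x : E3 | x 2 ≤ 0}] y) := by
      refine tendsto_nhdsWithin_iff.2 ⟨?_, Eventually.of_forall fun n => ?_⟩
      · have : Tendsto (fun n => y + (-δ n) • e) atTop (𝓝 (y + (-0 : ℝ) • e)) :=
          tendsto_const_nhds.add (hδt.neg.smul_const e)
        simpa using this
      · have := hδ0 n
        show (y + (-δ n) • e) 2 ≤ 0
        rw [hc2]; linarith
    exact (hwc y hy).tendsto.comp h1
  have hwb : ∀ n (y : E3), y 2 ≤ 0 → ‖y‖ ≤ L → ‖w (y + (-δ n) • e)‖ ≤ M := by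
    intro n y h1 h2
    refine hM _ ?_ ?_
    · have := hδ0 n
      rw [hc2]; linarith
    · refine (norm_add_le _ _).trans ?_
      rw [norm_smul, he, norm_neg, Real.norm_eq_abs, abs_of_pos (hδ0 n)]
      have := hδ1 n
      linarith
  have hwcn : ∀ n, ContinuousOn (fun y => w (y + (-δ n) • e)) {x : E3 | x 2 ≤ 0} := by
    intro n
    refine hwc.comp (by fun_prop) ?_
    intro y hy
    have := hδ0 n
    show (y + (-δ n) • e) 2 ≤ 0
    have hy' : y 2 ≤ 0 := hy
    rw [hc2]; linarith
  have t1 : Tendsto (fun n => ∫ y in {y : E3 | y 2 < 0}, w (y + (-δ n) • e) * D y) atTop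
      (𝓝 (∫ y in {y : E3 | y 2 < 0}, w y * D y)) := by
    refine tendsto_integral_of_dominated_convergence (fun y => M * ‖D y‖) ?_ ?_ ?_ ?_
    · intro n
      have hsub : {y : E3 | y 2 < 0} ⊆ {y : E3 | y 2 ≤ 0} := fun y (hy : y 2 < 0) => hy.le
      exact (((hwcn n).mono hsub).mul hDc.continuousOn).aestronglyMeasurable
        isOpen_half.measurableSet
    · exact (hDi.norm.const_mul M).restrict
    · intro n
      filter_upwards [ae_restrict_mem isOpen_half.measurableSet] with y hy
      rw [norm_mul]
      by_cases h : ‖y‖ ≤ L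
      · exact mul_le_mul_of_nonneg_right (hwb n y (le_of_lt hy) h) (norm_nonneg _)
      · rw [hD0 y (not_le.1 h)]; simp
    · filter_upwards [ae_restrict_mem isOpen_half.measurableSet] with y hy
      exact (hwt y (le_of_lt hy)).mul_const _
  let D2 : ℝ × ℝ → ℂ := fun p => dd 2 v (pt3 p.1 p.2 0)
  have hpc : Continuous fun p : ℝ × ℝ => pt3 p.1 p.2 0 :=
    continuous_pt3.comp (by fun_prop : Continuous fun p : ℝ × ℝ => (p.1, p.2, (0:ℝ)))
  have hD2c : Continuous D2 := (continuous_dd hv 2).comp hpc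
  have hD20 : ∀ p : ℝ × ℝ, L < ‖pt3 p.1 p.2 0‖ → D2 p = 0 := fun p hp =>
    dd_zero_of_far hL 2 _ hp
  have hD2i : Integrable D2 := by
    refine hD2c.integrable_of_hasCompactSupport ?_
    refine HasCompactSupport.intro (isCompact_closedBall (0 : ℝ × ℝ) L) fun p hp => hD20 p ?_
    have h1 : L < ‖p‖ := by simpa using hp
    refine h1.trans_le ?_
    rw [Prod.norm_def]
    exact max_le (abs_coord_le (pt3 p.1 p.2 0) 0) (abs_coord_le (pt3 p.1 p.2 0) 1)
  have t2 : Tendsto (fun n => ∫ p : ℝ × ℝ, w (pt3 p.1 p.2 0 + (-δ n) • e) * D2 p) atTop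
      (𝓝 (∫ p : ℝ × ℝ, w (pt3 p.1 p.2 0) * D2 p)) := by
    refine tendsto_integral_of_dominated_convergence (fun p => M * ‖D2 p‖) ?_ ?_ ?_ ?_
    · intro n
      have : Continuous fun p : ℝ × ℝ => w (pt3 p.1 p.2 0 + (-δ n) • e) :=
        (hwcn n).comp_continuous hpc (fun p => le_of_eq (pt3_apply2 _ _ _))
      exact (this.mul hD2c).aestronglyMeasurable
    · exact hD2i.norm.const_mul M
    · intro n
      refine Eventually.of_forall fun p => ?_
      rw [norm_mul]
      by_cases h : ‖pt3 p.1 p.2 0‖ ≤ L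
      · exact mul_le_mul_of_nonneg_right (hwb n _ (le_of_eq (pt3_apply2 _ _ _)) h) (norm_nonneg _)
      · rw [hD20 p (not_le.1 h)]; simp
    · refine Eventually.of_forall fun p => ?_
      exact (hwt _ (le_of_eq (pt3_apply2 _ _ _))).mul_const _
  simp only [hg] at t1
  exact tendsto_nhds_unique t1 t2

end Part3

section Part4

open MeasureTheory Filter Topology



/-- smooth step: 0 for r ≤ 1, 1 for r ≥ 2 -/
def st (r : ℝ) : ℂ := ((Real.smoothTransition (r - 1) : ℝ) : ℂ)
def st1 : ℝ → ℂ := deriv st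
def st2 : ℝ → ℂ := deriv st1

lemma st_contDiff (n : ℕ) : ContDiff ℝ n st := by
  unfold st
  have h : ContDiff ℝ ((n : ℕ∞)) (fun r : ℝ => Real.smoothTransition (r - 1)) :=
    Real.smoothTransition.contDiff.comp (contDiff_id.sub contDiff_const)
  exact Complex.ofRealCLM.contDiff.comp h

lemma st1_contDiff (n : ℕ) : ContDiff ℝ n st1 := by
  have := st_contDiff (n + 1)
  push_cast at this
  exact (contDiff_succ_iff_deriv.1 this).2.2

lemma st2_contDiff (n : ℕ) : ContDiff ℝ n st2 := by
  have := st1_contDiff (n + 1)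
  push_cast at this
  exact (contDiff_succ_iff_deriv.1 this).2.2

lemma st_hasDerivAt (r : ℝ) : HasDerivAt st (st1 r) r :=
  ((st_contDiff 1).differentiable (by simp) r).hasDerivAt

lemma st1_hasDerivAt (r : ℝ) : HasDerivAt st1 (st2 r) r :=
  ((st1_contDiff 1).differentiable (by simp) r).hasDerivAt

lemma st_continuous : Continuous st := (st_contDiff 1).continuous
lemma st1_continuous : Continuous st1 := (st1_contDiff 1).continuous
lemma st2_continuous : Continuous st2 := (st2_contDiff 1).continuous

lemma st_zero {r : ℝ} (h : r ≤ 1) : st r = 0 := by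
  simp [st, Real.smoothTransition.zero_of_nonpos (by linarith : r - 1 ≤ 0)]

lemma st_one {r : ℝ} (h : 2 ≤ r) : st r = 1 := by
  simp [st, Real.smoothTransition.one_of_one_le (by linarith : 1 ≤ r - 1)]

lemma st_norm (r : ℝ) : ‖st r‖ ≤ 1 := by
  simp only [st, Complex.norm_real, Real.norm_eq_abs, abs_of_nonneg (Real.smoothTransition.nonneg _)]
  exact Real.smoothTransition.le_one _

lemma deriv_zero_left {f : ℝ → ℂ} {c : ℂ} {a : ℝ} (hc : Continuous (deriv f))
    (h : ∀ r ≤ a, f r = c) : ∀ r ≤ a, deriv f r = 0 := by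
  have h1 : Set.Iio a ⊆ {r | deriv f r = 0} := by
    intro r hr
    have : f =ᶠ[𝓝 r] fun _ => c := by
      filter_upwards [Iio_mem_nhds hr] with z hz using h z (le_of_lt hz)
    show deriv f r = 0
    rw [this.deriv_eq]; simp
  have h2 := closure_minimal h1 (isClosed_eq hc continuous_const)
  rw [closure_Iio] at h2
  exact fun r hr => h2 hr

lemma deriv_zero_right {f : ℝ → ℂ} {c : ℂ} {a : ℝ} (hc : Continuous (deriv f))
    (h : ∀ r, a ≤ r → f r = c) : ∀ r, a ≤ r → deriv f r = 0 := by
  have h1 : Set.Ioi a ⊆ {r | deriv f r = 0} := by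
    intro r hr
    have : f =ᶠ[𝓝 r] fun _ => c := by
      filter_upwards [Ioi_mem_nhds hr] with z hz using h z (le_of_lt hz)
    show deriv f r = 0
    rw [this.deriv_eq]; simp
  have h2 := closure_minimal h1 (isClosed_eq hc continuous_const)
  rw [closure_Ioi] at h2
  exact fun r hr => h2 hr

lemma st1_left {r : ℝ} (h : r ≤ 1) : st1 r = 0 :=
  deriv_zero_left st1_continuous (fun _ => st_zero) r h
lemma st1_right {r : ℝ} (h : 2 ≤ r) : st1 r = 0 :=
  deriv_zero_right st1_continuous (fun _ => st_one) r h
lemma st2_left {r : ℝ} (h : r ≤ 1) : st2 r = 0 :=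
  deriv_zero_left st2_continuous (fun _ => st1_left) r h
lemma st2_right {r : ℝ} (h : 2 ≤ r) : st2 r = 0 :=
  deriv_zero_right st2_continuous (fun _ => st1_right) r h

lemma st_bounds : ∃ C : ℝ, 0 < C ∧ ∀ r, ‖st1 r‖ ≤ C ∧ ‖st2 r‖ ≤ C := by
  obtain ⟨C1, h1⟩ := (isCompact_Icc (a := (1:ℝ)) (b := 2)).exists_bound_of_continuousOn
    st1_continuous.continuousOn
  obtain ⟨C2, h2⟩ := (isCompact_Icc (a := (1:ℝ)) (b := 2)).exists_bound_of_continuousOn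
    st2_continuous.continuousOn
  have p1 : 0 ≤ C1 := (norm_nonneg _).trans (h1 1 (by norm_num))
  have p2 : 0 ≤ C2 := (norm_nonneg _).trans (h2 1 (by norm_num))
  refine ⟨C1 + C2 + 1, by linarith, fun r => ?_⟩
  rcases le_total r 1 with h | h
  · rw [st1_left h, st2_left h]; simp; linarith
  rcases le_total 2 r with h' | h'
  · rw [st1_right h', st2_right h']; simp; linarith
  exact ⟨(h1 r ⟨h, h'⟩).trans (by linarith), (h2 r ⟨h, h'⟩).trans (by linarith)⟩

lemma st_scaled (ε ρ : ℝ) : HasDerivAt (fun t : ℝ => st (t / ε)) (st1 (ρ / ε) / (ε : ℂ)) ρ := by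
  have := (st_hasDerivAt (ρ / ε)).scomp ρ ((hasDerivAt_id ρ).div_const ε)
  refine this.congr_deriv ?_
  rw [Complex.real_smul]
  push_cast
  ring

lemma st1_scaled (ε ρ : ℝ) : HasDerivAt (fun t : ℝ => st1 (t / ε)) (st2 (ρ / ε) / (ε : ℂ)) ρ := by
  have := (st1_hasDerivAt (ρ / ε)).scomp ρ ((hasDerivAt_id ρ).div_const ε)
  refine this.congr_deriv ?_
  rw [Complex.real_smul]
  push_cast
  ring

lemma exp_hasDerivAt (κ : ℂ) (ρ : ℝ) :
    HasDerivAt (fun t : ℝ => Complex.exp (Complex.I * κ * t))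
      (Complex.I * κ * Complex.exp (Complex.I * κ * ρ)) ρ := by
  have h : HasDerivAt (fun t : ℝ => Complex.I * κ * (t : ℂ)) (Complex.I * κ) ρ := by
    simpa using (HasDerivAt.ofReal_comp (hasDerivAt_id ρ)).const_mul (Complex.I * κ)
  simpa [mul_comm] using h.cexp

/-- regularised outgoing kernel -/
def fe (κ : ℂ) (ε ρ : ℝ) : ℂ := st (ρ / ε) * Complex.exp (Complex.I * κ * ρ) / ρ
def fe1 (κ : ℂ) (ε ρ : ℝ) : ℂ :=
  (st1 (ρ / ε) / ε + Complex.I * κ * st (ρ / ε)) * Complex.exp (Complex.I * κ * ρ) / ρ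
    - st (ρ / ε) * Complex.exp (Complex.I * κ * ρ) / ρ ^ 2
def src (κ : ℂ) (ε ρ : ℝ) : ℂ :=
  (st2 (ρ / ε) / ε ^ 2 + 2 * Complex.I * κ * st1 (ρ / ε) / ε) *
    Complex.exp (Complex.I * κ * ρ) / ρ

lemma fe_hasDerivAt (κ : ℂ) {ε ρ : ℝ} (hρ : ρ ≠ 0) : HasDerivAt (fe κ ε) (fe1 κ ε ρ) ρ := by
  have hρc : (ρ : ℂ) ≠ 0 := by exact_mod_cast hρ
  have h := ((st_scaled ε ρ).mul (exp_hasDerivAt κ ρ)).div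
    (HasDerivAt.ofReal_comp (hasDerivAt_id ρ)) hρc
  refine h.congr_deriv ?_
  simp only [fe1, id, Complex.ofReal_one, Pi.mul_apply]
  field_simp

lemma fe1_hasDerivAt (κ : ℂ) {ε ρ : ℝ} (hρ : ρ ≠ 0) :
    HasDerivAt (fe1 κ ε) (src κ ε ρ - κ ^ 2 * fe κ ε ρ - 2 * fe1 κ ε ρ / ρ) ρ := by
  have hρc : (ρ : ℂ) ≠ 0 := by exact_mod_cast hρ
  have h0 := (st_scaled ε ρ)
  have h1 := (st1_scaled ε ρ)
  have he := exp_hasDerivAt κ ρ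
  have hr : HasDerivAt (fun t : ℝ => (t : ℂ)) 1 ρ := by
    simpa using (HasDerivAt.ofReal_comp (hasDerivAt_id ρ))
  have h := ((((h1.div_const (ε : ℂ)).add (h0.const_mul (Complex.I * κ))).mul he).div hr hρc).sub
    ((h0.mul he).div (hr.pow 2) (pow_ne_zero 2 hρc))
  refine h.congr_deriv ?_
  simp only [fe1, fe, src, Pi.mul_apply, Pi.add_apply, Pi.pow_apply]
  by_cases hε : (ε : ℂ) = 0
  · simp only [hε, div_zero]
    field_simp
    ring_nf
    simp [Complex.I_sq]
    ring
  field_simp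
  ring_nf
  simp [Complex.I_sq]
  ring

def feE (κ : ℂ) (ε : ℝ) (a : E3) (y : E3) : ℂ := fe κ ε ‖y - a‖

lemma fe_zero (κ : ℂ) {ε ρ : ℝ} (hε : 0 < ε) (h : ρ ≤ ε) : fe κ ε ρ = 0 := by
  simp [fe, st_zero ((div_le_one hε).2 h)]

lemma feE_ev_zero (κ : ℂ) {ε : ℝ} (hε : 0 < ε) (a : E3) :
    feE κ ε a =ᶠ[𝓝 a] fun _ => 0 := by
  filter_upwards [Metric.ball_mem_nhds a hε] with z hz
  rw [Metric.mem_ball, dist_eq_norm] at hz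
  exact fe_zero κ hε hz.le

lemma feE_contDiff (κ : ℂ) {ε : ℝ} (hε : 0 < ε) (a : E3) : ContDiff ℝ 2 (feE κ ε a) := by
  rw [contDiff_iff_contDiffAt]
  intro y
  by_cases h : y = a
  · subst h
    exact contDiffAt_const.congr_of_eventuallyEq (feE_ev_zero κ hε y)
  · have h0 : y - a ≠ 0 := sub_ne_zero.2 h
    have hn : ContDiffAt ℝ 2 (fun z : E3 => ‖z - a‖) y :=
      (contDiffAt_id.sub contDiffAt_const).norm ℝ h0
    have hnc : ContDiffAt ℝ 2 (fun z : E3 => ((‖z - a‖ : ℝ) : ℂ)) y :=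
      Complex.ofRealCLM.contDiff.contDiffAt.comp y hn
    have hs : ContDiffAt ℝ 2 (fun z : E3 => st (‖z - a‖ / ε)) y :=
      (st_contDiff 2).contDiffAt.comp y (hn.div_const ε)
    have hne : ((‖y - a‖ : ℝ) : ℂ) ≠ 0 := by
      exact_mod_cast norm_ne_zero_iff.2 h0
    unfold feE fe
    simp only [div_eq_mul_inv] at hs ⊢
    exact (hs.mul (contDiffAt_const.mul hnc).cexp).mul (hnc.inv hne)

lemma src_zero (κ : ℂ) {ε ρ : ℝ} (hε : 0 < ε) (h : ρ ≤ ε) : src κ ε ρ = 0 := by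
  simp [src, st1_left ((div_le_one hε).2 h), st2_left ((div_le_one hε).2 h)]

lemma src_zero' (κ : ℂ) {ε ρ : ℝ} (hε : 0 < ε) (h : 2 * ε ≤ ρ) : src κ ε ρ = 0 := by
  have : 2 ≤ ρ / ε := (le_div_iff₀ hε).2 h
  simp [src, st1_right this, st2_right this]

lemma feE_lap (κ : ℂ) {ε : ℝ} (hε : 0 < ε) (a y : E3) :
    lap3 (feE κ ε a) y + κ ^ 2 * feE κ ε a y = src κ ε ‖y - a‖ := by
  by_cases h : y = a
  · subst h
    rw [lap3_congr (feE_ev_zero κ hε y), (feE_ev_zero κ hε y).self_of_nhds, sub_self, norm_zero,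
      src_zero κ hε hε.le]
    simp [lap3]
  · have h0 : ‖y - a‖ ≠ 0 := norm_ne_zero_iff.2 (sub_ne_zero.2 h)
    have := radial_lap3 (g := fe κ ε) (g1 := fe1 κ ε) h ?_ (fe1_hasDerivAt κ h0)
    · unfold feE
      rw [this]; ring
    · filter_upwards [isOpen_ne.mem_nhds h0] with t ht
      exact fe_hasDerivAt κ ht

/-- radial cutoff -/
def chi (R r : ℝ) : ℂ := 1 - st (r / R)

lemma chi_hasDerivAt (R r : ℝ) : HasDerivAt (chi R) (-(st1 (r / R) / R)) r := by
  have h := (st_scaled R r).const_sub 1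
  exact h

lemma chi1_hasDerivAt (R r : ℝ) :
    HasDerivAt (fun r => -(st1 (r / R) / (R : ℂ))) (-(st2 (r / R) / R / R)) r :=
  ((st1_scaled R r).div_const _).neg

def chiE (R : ℝ) (y : E3) : ℂ := chi R ‖y - 0‖

lemma chi_one {R r : ℝ} (hR : 0 < R) (h : r ≤ R) : chi R r = 1 := by
  simp [chi, st_zero ((div_le_one hR).2 h)]

lemma chi_zero {R r : ℝ} (hR : 0 < R) (h : 2 * R ≤ r) : chi R r = 0 := by
  simp [chi, st_one ((le_div_iff₀ hR).2 h)]

lemma chiE_ev {R : ℝ} (hR : 0 < R) : chiE R =ᶠ[𝓝 0] fun _ => 1 := by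
  filter_upwards [Metric.ball_mem_nhds 0 hR] with z hz
  rw [Metric.mem_ball, dist_eq_norm] at hz
  exact chi_one hR hz.le

lemma chiE_contDiff {R : ℝ} (hR : 0 < R) : ContDiff ℝ 2 (chiE R) := by
  rw [contDiff_iff_contDiffAt]
  intro y
  by_cases h : y = 0
  · subst h
    exact contDiffAt_const.congr_of_eventuallyEq (chiE_ev hR)
  · have h0 : y - 0 ≠ 0 := sub_ne_zero.2 h
    have hn : ContDiffAt ℝ 2 (fun z : E3 => ‖z - 0‖) y :=
      (contDiffAt_id.sub contDiffAt_const).norm ℝ h0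
    have hs : ContDiffAt ℝ 2 (fun z : E3 => st (‖z - 0‖ / R)) y :=
      (st_contDiff 2).contDiffAt.comp y (hn.div_const R)
    unfold chiE chi
    exact contDiffAt_const.sub hs

lemma fderiv_apply_sum (u : E3 → ℂ) (y z : E3) :
    fderiv ℝ u y z = ∑ i, (z i : ℂ) * dd i u y := by
  have : z = ∑ i, z i • (EuclideanSpace.single i (1:ℝ) : E3) := by
    ext j
    simp [Finset.sum_apply, Pi.single_apply]
  conv_lhs => rw [this]
  simp [dd]

/-- The cutoff commutator. -/
lemma cut_lap (κ : ℂ) {R : ℝ} (hR : 0 < R) {u : E3 → ℂ} (hu : ContDiff ℝ 2 u) (y : E3)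
    (hy : y ≠ 0) :
    lap3 (fun z => chiE R z * u z) y + κ ^ 2 * (chiE R y * u y)
      = chiE R y * (lap3 u y + κ ^ 2 * u y)
        + (2 * (-(st1 (‖y‖ / R) / R)) * (fderiv ℝ u y y / ‖y‖)
          + u y * (-(st2 (‖y‖ / R) / R / R) + 2 * (-(st1 (‖y‖ / R) / R)) / ‖y‖)) := by
  have hl := radial_lap3 (g := chi R) (g1 := fun r => -(st1 (r / R) / (R : ℂ))) hy
    (Eventually.of_forall fun t => chi_hasDerivAt R t) (chi1_hasDerivAt R _)
  have hd : ∀ i, dd i (chiE R) y = _ := fun i => radial_dd (g := chi R) hy (chi_hasDerivAt R _) i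
  rw [lap3_mul (chiE_contDiff hR).contDiffAt hu.contDiffAt, show lap3 (chiE R) y = _ from hl,
    fderiv_apply_sum]
  simp only [hd]
  simp only [Fin.sum_univ_three, sub_zero, PiLp.zero_apply]
  push_cast
  ring

end Part4

section Part5

open MeasureTheory Filter Topology



lemma norm_sub_pt3 (y : E3) (a b c : ℝ) :
    ‖y - pt3 a b c‖ = Real.sqrt ((y 0 - a) ^ 2 + (y 1 - b) ^ 2 + (y 2 - c) ^ 2) := by
  rw [EuclideanSpace.norm_eq, Fin.sum_univ_three]
  simp only [PiLp.sub_apply, pt3_apply0, pt3_apply1, pt3_apply2, Real.norm_eq_abs, sq_abs]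

lemma half_integrable {w f : E3 → ℂ} (hw : ContinuousOn w {x : E3 | x 2 ≤ 0})
    (hf : Continuous f) {L : ℝ} (hL : ∀ y, L < ‖y‖ → f y = 0) :
    IntegrableOn (fun y => w y * f y) {y : E3 | y 2 < 0} := by
  have hK : IsCompact (Metric.closedBall (0:E3) L ∩ {x : E3 | x 2 ≤ 0}) :=
    (isCompact_closedBall _ _).inter_right isClosed_half
  have h1 : IntegrableOn (fun y => w y * f y) (Metric.closedBall (0:E3) L ∩ {x : E3 | x 2 ≤ 0}) :=
    ((hw.mul hf.continuousOn).mono Set.inter_subset_right).integrableOn_compact hK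
  refine (h1.of_forall_sdiff_eq_zero ?_ ?_ : IntegrableOn _ {y : E3 | y 2 ≤ 0}).mono_set
    (fun y (hy : y 2 < 0) => (le_of_lt hy : y 2 ≤ 0))
  · exact isClosed_half.measurableSet
  · intro y hy
    have : L < ‖y‖ := by
      by_contra hc
      push Not at hc
      exact hy.2 ⟨by simpa using hc, hy.1⟩
    rw [hL y this, mul_zero]

/-- regularised half-space Green function -/
def uE (κ : ℂ) (ε h : ℝ) (p : ℝ × ℝ) (y : E3) : ℂ :=
  feE κ ε (pt3 p.1 p.2 (-h)) y - feE κ ε (pt3 p.1 p.2 h) y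

/-- distance -/
def rho (h : ℝ) (d : ℝ × ℝ) : ℝ := Real.sqrt (d.1 ^ 2 + d.2 ^ 2 + h ^ 2)

/-- boundary kernel -/
def Mk (κ : ℂ) (h : ℝ) (d : ℝ × ℝ) : ℂ :=
  2 * h * (Complex.exp (Complex.I * κ * rho h d) * (Complex.I * κ / rho h d - 1 / (rho h d) ^ 2))
    / rho h d

lemma uE_contDiff (κ : ℂ) {ε : ℝ} (hε : 0 < ε) (h : ℝ) (p : ℝ × ℝ) :
    ContDiff ℝ 2 (uE κ ε h p) :=
  (feE_contDiff κ hε _).sub (feE_contDiff κ hε _)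

lemma uE_plane (κ : ℂ) (ε h : ℝ) (p : ℝ × ℝ) (y : E3) (hy : y 2 = 0) : uE κ ε h p y = 0 := by
  simp [uE, feE, norm_sub_pt3, hy]

lemma rho_ge {h : ℝ} (d : ℝ × ℝ) : h ≤ rho h d :=
  Real.le_sqrt_of_sq_le (by nlinarith [sq_nonneg d.1, sq_nonneg d.2])

lemma feE_dd_far (κ : ℂ) {ε : ℝ} (hε : 0 < ε) (a y : E3) (h : 2 * ε ≤ ‖y - a‖) (i : Fin 3) :
    dd i (feE κ ε a) y = Complex.exp (Complex.I * κ * ‖y - a‖) *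
      (Complex.I * κ / ‖y - a‖ - 1 / (‖y - a‖ : ℂ) ^ 2) * ((y i - a i : ℝ) : ℂ) / ‖y - a‖ := by
  have hpos : 0 < ‖y - a‖ := by linarith
  have hne : y ≠ a := by
    rintro rfl
    simp at hpos
  have h2 : 2 ≤ ‖y - a‖ / ε := (le_div_iff₀ hε).2 h
  have := radial_dd (g := fe κ ε) hne (fe_hasDerivAt κ hpos.ne') i
  unfold feE
  rw [this, fe1, st1_right h2, st_one h2]
  push_cast
  ring

lemma uE_dd (κ : ℂ) {ε h : ℝ} (hε : 0 < ε) (hh : 2 * ε ≤ h) (p q : ℝ × ℝ) :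
    dd 2 (uE κ ε h p) (pt3 q.1 q.2 0) = Mk κ h (p - q) := by
  unfold uE
  have e1 : ‖pt3 q.1 q.2 0 - pt3 p.1 p.2 (-h)‖ = rho h (p - q) := by
    rw [norm_sub_pt3, rho]; simp only [pt3_apply0, pt3_apply1, pt3_apply2, Prod.fst_sub, Prod.snd_sub]
    congr 1; ring
  have e2 : ‖pt3 q.1 q.2 0 - pt3 p.1 p.2 h‖ = rho h (p - q) := by
    rw [norm_sub_pt3, rho]; simp only [pt3_apply0, pt3_apply1, pt3_apply2, Prod.fst_sub, Prod.snd_sub]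
    congr 1; ring
  rw [dd_sub ((feE_contDiff κ hε _).differentiable (by simp) _)
    ((feE_contDiff κ hε _).differentiable (by simp) _),
    feE_dd_far κ hε _ _ (by rw [e1]; linarith [rho_ge (h := h) (p - q)]),
    feE_dd_far κ hε _ _ (by rw [e2]; linarith [rho_ge (h := h) (p - q)]), e1, e2, Mk]
  simp only [pt3_apply2]
  push_cast
  ring

lemma uE_lap (κ : ℂ) {ε h : ℝ} (hε : 0 < ε) (hh : 2 * ε ≤ h) (p : ℝ × ℝ) (y : E3) (hy : y 2 < 0) :
    lap3 (uE κ ε h p) y + κ ^ 2 * uE κ ε h p y = src κ ε ‖y - pt3 p.1 p.2 (-h)‖ := by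
  have h2 : 2 * ε ≤ ‖y - pt3 p.1 p.2 h‖ := by
    refine le_trans ?_ (abs_coord_le _ 2)
    simp only [PiLp.sub_apply, pt3_apply2]
    rw [abs_of_neg (by linarith)]; linarith
  have := feE_lap κ hε (pt3 p.1 p.2 h) y
  rw [src_zero' κ hε h2] at this
  unfold uE
  rw [lap3_sub (feE_contDiff κ hε _).contDiffAt (feE_contDiff κ hε _).contDiffAt,
    ← feE_lap κ hε]
  linear_combination -this

lemma src_continuous (κ : ℂ) {ε : ℝ} (hε : 0 < ε) (a : E3) :
    Continuous fun y : E3 => src κ ε ‖y - a‖ := by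
  have : (fun y : E3 => src κ ε ‖y - a‖) = fun y => lap3 (feE κ ε a) y + κ ^ 2 * feE κ ε a y := by
    funext y; rw [feE_lap κ hε]
  rw [this]
  exact (continuous_lap3 (feE_contDiff κ hε a)).add
    (continuous_const.mul (feE_contDiff κ hε a).continuous)

/-- cutoff error -/
def Er (κ : ℂ) (R : ℝ) (u : E3 → ℂ) (y : E3) : ℂ :=
  lap3 (fun z => chiE R z * u z) y + κ ^ 2 * (chiE R y * u y)
    - chiE R y * (lap3 u y + κ ^ 2 * u y)

lemma chiE_far {R : ℝ} (hR : 0 < R) (y : E3) (hy : 2 * R < ‖y‖) : chiE R y = 0 := by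
  rw [chiE, sub_zero, chi_zero hR hy.le]

theorem green_cut (κ : ℂ) {w : E3 → ℂ}
    (hwc : ContinuousOn w {x : E3 | x 2 ≤ 0})
    (hw : ContDiffOn ℝ 2 w {x : E3 | x 2 < 0})
    (hH : ∀ x : E3, x 2 < 0 → lap3 w x + κ ^ 2 * w x = 0)
    {ε h R : ℝ} (hε : 0 < ε) (hh : 2 * ε ≤ h) (p : ℝ × ℝ)
    (hR : ‖pt3 p.1 p.2 (-h)‖ + 2 * ε ≤ R) :
    (∫ y in {y : E3 | y 2 < 0}, w y * src κ ε ‖y - pt3 p.1 p.2 (-h)‖)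
      + (∫ y in {y : E3 | y 2 < 0}, w y * Er κ R (uE κ ε h p) y)
      = ∫ q : ℝ × ℝ, w (pt3 q.1 q.2 0) * (chiE R (pt3 q.1 q.2 0) * Mk κ h (p - q)) := by
  have hR0 : 0 < R := by linarith [norm_nonneg (pt3 p.1 p.2 (-h))]
  have hu := uE_contDiff κ hε h p
  have hv : ContDiff ℝ 2 (fun z => chiE R z * uE κ ε h p z) := (chiE_contDiff hR0).mul hu
  have hvL : ∀ y, 2 * R < ‖y‖ → chiE R y * uE κ ε h p y = 0 := fun y hy => by
    rw [chiE_far hR0 y hy, zero_mul]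
  have hg := green κ hwc hw hH hv hvL (fun y hy => by rw [uE_plane κ ε h p y hy, mul_zero])
  have hb : ∀ q : ℝ × ℝ, dd 2 (fun z => chiE R z * uE κ ε h p z) (pt3 q.1 q.2 0)
      = chiE R (pt3 q.1 q.2 0) * Mk κ h (p - q) := by
    intro q
    rw [dd_mul ((chiE_contDiff hR0).differentiable (by simp) _) (hu.differentiable (by simp) _),
      uE_dd κ hε hh, uE_plane κ ε h p _ (pt3_apply2 _ _ _)]
    ring
  simp only [hb] at hg
  rw [← hg, ← integral_add]
  · refine setIntegral_congr_fun isOpen_half.measurableSet fun y hy => ?_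
    have hl := uE_lap κ hε hh p y hy
    have : chiE R y * (lap3 (uE κ ε h p) y + κ ^ 2 * uE κ ε h p y)
        = src κ ε ‖y - pt3 p.1 p.2 (-h)‖ := by
      rw [hl]
      by_cases hy2 : 2 * ε ≤ ‖y - pt3 p.1 p.2 (-h)‖
      · rw [src_zero' κ hε hy2, mul_zero]
      · push Not at hy2
        rw [chiE, sub_zero, chi_one hR0, one_mul]
        have := norm_le_norm_add_norm_sub' y (pt3 p.1 p.2 (-h))
        linarith
    simp only [Er, this]
    ring
  · refine half_integrable hwc (src_continuous κ hε _) (L := R) fun y hy => ?_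
    apply src_zero' κ hε
    have := norm_le_norm_add_norm_sub' y (pt3 p.1 p.2 (-h))
    linarith
  · refine half_integrable hwc (L := 2 * R) ?_ fun y hy => ?_
    · have c1 := continuous_lap3 hv
      have c2 := continuous_lap3 hu
      have c3 := (chiE_contDiff hR0).continuous
      have c4 := hu.continuous
      unfold Er
      fun_prop
    · rw [Er, lap3_zero_of_far hvL y hy, chiE_far hR0 y hy]
      ring

end Part5

section Part6

open MeasureTheory Filter Topology



/-- surface measure constant -/
def sphC : ℝ := (volume : Measure E3).toSphere.real Set.univ

lemma sphC_nonneg : 0 ≤ sphC := measureReal_nonneg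

theorem polar_bound {F : E3 → ℂ} {η : ℝ} (hη : 0 ≤ η)
    (hF : ∀ θ : E3, ‖θ‖ = 1 → ‖∫ r in Set.Ioi (0:ℝ), ((r ^ 2 : ℝ) : ℂ) * F (r • θ)‖ ≤ η) :
    ‖∫ y, F y‖ ≤ sphC * η := by
  by_cases hi : Integrable F
  swap
  · rw [integral_undef hi, norm_zero]
    exact mul_nonneg sphC_nonneg hη
  have hd : Module.finrank ℝ E3 = 3 := by simp
  have mp := (volume : Measure E3).measurePreserving_homeomorphUnitSphereProd
  have me : MeasurableEmbedding (homeomorphUnitSphereProd E3) := Homeomorph.measurableEmbedding _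
  let H : (Metric.sphere (0:E3) 1) × Set.Ioi (0:ℝ) → ℂ := fun z => F (z.2.1 • z.1.1)
  have hH : ∀ x : ({0}ᶜ : Set E3), H (homeomorphUnitSphereProd E3 x) = F x.1 := by
    intro x
    simp only [H]
    congr 1
    have : x.1 ≠ 0 := x.2
    simp [smul_smul, this]
  have e1 : ∫ y, F y = ∫ z, H z ∂((volume : Measure E3).toSphere.prod
      (.volumeIoiPow (Module.finrank ℝ E3 - 1))) := by
    rw [← mp.integral_comp me]
    simp only [hH]
    rw [integral_subtype_comap (measurableSet_singleton _).compl F, restrict_compl_singleton]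
  have i1 : Integrable H ((volume : Measure E3).toSphere.prod
      (.volumeIoiPow (Module.finrank ℝ E3 - 1))) := by
    rw [← mp.integrable_comp_emb me]
    have : H ∘ (homeomorphUnitSphereProd E3) = F ∘ Subtype.val := funext hH
    rw [this]
    rw [← MeasurableEmbedding.integrableOn_range_iff_comap]
    · simpa using hi.integrableOn
    · exact MeasurableEmbedding.subtype_coe (measurableSet_singleton _).compl
  rw [e1, integral_prod _ i1, mul_comm]
  have := norm_integral_le_of_norm_le_const (μ := (volume : Measure E3).toSphere) (C := η)
    (f := fun θ => ∫ r, H (θ, r) ∂(Measure.volumeIoiPow (Module.finrank ℝ E3 - 1))) ?_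
  · exact this
  refine Eventually.of_forall fun θ => ?_
  have hθ : ‖θ.1‖ = 1 := by simpa using θ.2
  refine le_of_eq_of_le ?_ (hF θ.1 hθ)
  congr 1
  rw [hd]
  simp only [Measure.volumeIoiPow, ENNReal.ofReal]
  rw [integral_withDensity_eq_integral_smul,
        integral_subtype_comap measurableSet_Ioi
          fun a ↦ Real.toNNReal (a ^ (3 - 1)) • F (a • θ.1),
        setIntegral_congr_fun measurableSet_Ioi fun x hx ↦ ?_]
  · simp only [NNReal.smul_def]
    rw [Real.coe_toNNReal _ (pow_nonneg (le_of_lt hx) _), Complex.real_smul]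
  · exact (measurable_subtype_coe.pow_const _).real_toNNReal

end Part6

section Part7

open MeasureTheory Filter Topology



lemma Er_continuous (κ : ℂ) {R : ℝ} (hR0 : 0 < R) {u : E3 → ℂ} (hu : ContDiff ℝ 2 u) :
    Continuous (Er κ R u) := by
  have c1 := continuous_lap3 ((chiE_contDiff hR0).mul hu)
  have c2 := continuous_lap3 hu
  have c3 := (chiE_contDiff hR0).continuous
  have c4 := hu.continuous
  unfold Er
  fun_prop

lemma ray_abs {R K : ℝ} {J P P' : ℝ → ℂ} (hR : 0 < R) (hJ : ContinuousOn J (Set.Ioi 0))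
    (hP : ∀ r ∈ Set.Icc R (2 * R), HasDerivAt P (P' r) r) (h1 : P R = 0) (h2 : P (2 * R) = 0)
    (hb : ∀ r ∈ Set.Icc R (2 * R), ‖J r - P' r‖ ≤ K / R)
    (hJ0 : ∀ r, 0 < r → r < R ∨ 2 * R < r → J r = 0) :
    ‖∫ r in Set.Ioi (0:ℝ), J r‖ ≤ K := by
  have e : ∫ r in Set.Ioi (0:ℝ), J r = ∫ r in R..(2 * R), J r := by
    rw [intervalIntegral.integral_of_le (by linarith), ← integral_Icc_eq_integral_Ioc]
    refine (setIntegral_eq_of_subset_of_forall_sdiff_eq_zero measurableSet_Ioi ?_ ?_)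
    · intro r hr; exact lt_of_lt_of_le hR hr.1
    · intro r hr
      refine hJ0 r hr.1 ?_
      by_contra hc
      push Not at hc
      exact hr.2 ⟨hc.1, hc.2⟩
  have hd : ∀ r ∈ Set.Icc R (2 * R), HasDerivAt (fun s => (∫ t in R..s, J t) - P s) (J r - P' r) r := by
    intro r hr
    have hr0 : 0 < r := lt_of_lt_of_le hR hr.1
    refine HasDerivAt.sub ?_ (hP r hr)
    refine intervalIntegral.integral_hasDerivAt_right ?_ ?_ (hJ.continuousAt (Ioi_mem_nhds hr0))
    · refine (hJ.mono ?_).intervalIntegrable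
      rw [Set.uIcc_of_le hr.1]
      exact fun z hz => lt_of_lt_of_le hR hz.1
    · exact hJ.stronglyMeasurableAtFilter isOpen_Ioi r hr0
  have := norm_image_sub_le_of_norm_deriv_le_segment' (fun r hr => (hd r hr).hasDerivWithinAt)
    (fun r hr => hb r (Set.Ico_subset_Icc_self hr)) (2 * R) ⟨by linarith, le_refl _⟩
  rw [e]
  simp only [intervalIntegral.integral_same, h1, h2, sub_zero] at this
  refine this.trans (le_of_eq ?_)
  field_simp
  ring

/-- Normalised kernel along a ray. -/
def Vr (κ : ℂ) (a θ : E3) (r : ℝ) : ℂ :=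
  r * Complex.exp (Complex.I * κ * ((‖r • θ - a‖ - r : ℝ) : ℂ)) / ‖r • θ - a‖

/-- Derivative of the normalised kernel. -/
def Vr' (κ : ℂ) (a θ : E3) (r : ℝ) : ℂ :=
  Complex.exp (Complex.I * κ * ((‖r • θ - a‖ - r : ℝ) : ℂ)) *
    ((((‖a‖ ^ 2 - inner ℝ θ a * r) / ‖r • θ - a‖ ^ 3 : ℝ) : ℂ)
      + Complex.I * κ * ((((r - inner ℝ θ a) / ‖r • θ - a‖ - 1) * (r / ‖r • θ - a‖) : ℝ) : ℂ))

lemma ray_sq {θ : E3} (hθ : ‖θ‖ = 1) (a : E3) (r : ℝ) :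
    ‖r • θ - a‖ ^ 2 = r ^ 2 - 2 * r * inner ℝ θ a + ‖a‖ ^ 2 := by
  rw [norm_sub_sq_real, norm_smul, hθ, inner_smul_left, mul_one, Real.norm_eq_abs, sq_abs]
  simp
  ring

lemma ray_low {θ : E3} (hθ : ‖θ‖ = 1) (a : E3) {r : ℝ} (hr : 0 ≤ r) :
    r - ‖a‖ ≤ ‖r • θ - a‖ := by
  have := norm_sub_norm_le (r • θ) a
  rwa [norm_smul, hθ, mul_one, Real.norm_eq_abs, abs_of_nonneg hr] at this

lemma Vr_hasDerivAt (κ : ℂ) {a θ : E3} (hθ : ‖θ‖ = 1) {r : ℝ} (hr : 2 * ‖a‖ + 1 ≤ r) :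
    HasDerivAt (Vr κ a θ) (Vr' κ a θ r) r := by
  have hr0 : 0 < r := by linarith [norm_nonneg a]
  have hlow := ray_low hθ a hr0.le
  have hpos : 0 < ‖r • θ - a‖ := by linarith [norm_nonneg a]
  have hne : r • θ ≠ a := by
    intro h; rw [h] at hpos; simp at hpos
  have hl : HasDerivAt (fun t : ℝ => t • θ) θ r := by
    simpa using (hasDerivAt_id r).smul_const θ
  have hρ : HasDerivAt (fun t : ℝ => ‖t • θ - a‖) ((r - inner ℝ θ a) / ‖r • θ - a‖) r := by
    have := (hasFDerivAt_dist hne).comp_hasDerivAt r hl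
    refine this.congr_deriv ?_
    simp only [_root_.smul_apply, innerSL_apply_apply, inner_sub_left, inner_smul_left,
      real_inner_self_eq_norm_sq, hθ, smul_eq_mul]
    rw [real_inner_comm θ a]
    simp
    ring
  have hρc := HasDerivAt.ofReal_comp hρ
  have hd := HasDerivAt.ofReal_comp (hρ.sub (hasDerivAt_id r))
  have hid := HasDerivAt.ofReal_comp (hasDerivAt_id r)
  have hnec : ((‖r • θ - a‖ : ℝ) : ℂ) ≠ 0 := by exact_mod_cast hpos.ne'
  have h := (hid.mul (hd.const_mul (Complex.I * κ)).cexp).div hρc hnec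
  refine h.congr_deriv ?_
  have hsq := ray_sq hθ a r
  have hsqc : ((‖a‖ : ℝ) : ℂ) ^ 2 = (‖r • θ - a‖ : ℂ) ^ 2 - r ^ 2 + 2 * r * (inner ℝ θ a : ℝ) := by
    have := congrArg (fun z : ℝ => (z : ℂ)) hsq
    push_cast at this
    linear_combination -this
  simp only [Vr', Pi.sub_apply, id, Pi.mul_apply]
  push_cast
  rw [hsqc]
  field_simp
  ring

lemma Vr_bounds (κ : ℂ) (hκ : 0 ≤ κ.im) (a : E3) : ∃ A : ℝ, 0 < A ∧ ∀ θ : E3, ‖θ‖ = 1 →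
    ∀ r : ℝ, 2 * ‖a‖ + 1 ≤ r → ‖Vr κ a θ r‖ ≤ A ∧ ‖Vr' κ a θ r‖ ≤ A / r ^ 2 := by
  set m := ‖a‖ with hm
  have hm0 : 0 ≤ m := norm_nonneg a
  refine ⟨Real.exp (κ.im * m) * (2 + 16 * m + 8 * ‖κ‖ * m ^ 2), by positivity, ?_⟩
  intro θ hθ r hr
  have hr0 : 0 < r := by linarith
  have hlow := ray_low hθ a hr0.le
  have hsq := ray_sq hθ a r
  have hb : |inner ℝ θ a| ≤ m := by
    have := abs_real_inner_le_norm θ a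
    rwa [hθ, one_mul] at this
  rw [← hm] at hlow hsq
  unfold Vr Vr'
  set ρ := ‖r • θ - a‖ with hρ
  set b : ℝ := inner ℝ θ a with hbdef
  have hρ2 : r / 2 ≤ ρ := by linarith
  have hρ0 : 0 < ρ := by linarith
  have hE : ‖Complex.exp (Complex.I * κ * ((ρ - r : ℝ) : ℂ))‖ ≤ Real.exp (κ.im * m) := by
    rw [Complex.norm_exp]
    apply Real.exp_le_exp.2
    have : (Complex.I * κ * ((ρ - r : ℝ) : ℂ)).re = - (κ.im * (ρ - r)) := by
      simp [Complex.mul_re, Complex.mul_im]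
    rw [this]
    nlinarith
  have hrρ : r / ρ ≤ 2 := by rw [div_le_iff₀ hρ0]; linarith
  obtain ⟨hb1, hb2⟩ := abs_le.1 hb
  constructor
  · rw [norm_div, norm_mul, Complex.norm_real, Complex.norm_real, Real.norm_eq_abs, Real.norm_eq_abs,
      abs_of_pos hr0, abs_of_pos hρ0]
    calc r * ‖Complex.exp (Complex.I * κ * ((ρ - r : ℝ) : ℂ))‖ / ρ
        = ‖Complex.exp (Complex.I * κ * ((ρ - r : ℝ) : ℂ))‖ * (r / ρ) := by ring
      _ ≤ Real.exp (κ.im * m) * 2 := by gcongr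
      _ ≤ _ := by
        gcongr
        have : 0 ≤ 16 * m + 8 * ‖κ‖ * m ^ 2 := by positivity
        linarith
  · rw [norm_mul, mul_div_assoc]
    refine mul_le_mul hE ?_ (norm_nonneg _) (Real.exp_pos _).le
    have t1 : |(m ^ 2 - b * r) / ρ ^ 3| ≤ 16 * m / r ^ 2 := by
      rw [abs_div, abs_of_pos (by positivity : 0 < ρ ^ 3)]
      have n1 : |m ^ 2 - b * r| ≤ 2 * m * r := by
        rw [abs_le]; constructor <;> nlinarith
      have n2 : (r / 2) ^ 3 ≤ ρ ^ 3 := by gcongr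
      calc |m ^ 2 - b * r| / ρ ^ 3 ≤ 2 * m * r / (r / 2) ^ 3 := by gcongr
        _ = _ := by field_simp; ring
    have t2 : |((r - b) / ρ - 1) * (r / ρ)| ≤ 8 * m ^ 2 / r ^ 2 := by
      have hs : 0 < r - b + ρ := by linarith
      have e : (r - b) / ρ - 1 = (b ^ 2 - m ^ 2) / (ρ * (r - b + ρ)) := by
        field_simp
        nlinarith
      rw [e, abs_mul, abs_div, abs_of_pos (by positivity : 0 < r / ρ),
        abs_of_pos (by positivity : 0 < ρ * (r - b + ρ))]
      have n1 : |b ^ 2 - m ^ 2| ≤ m ^ 2 := by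
        rw [abs_le]; constructor <;> nlinarith
      have n2 : (r / 2) * (r / 2) ≤ ρ * (r - b + ρ) := by
        apply mul_le_mul hρ2 <;> linarith
      calc |b ^ 2 - m ^ 2| / (ρ * (r - b + ρ)) * (r / ρ)
          ≤ m ^ 2 / ((r / 2) * (r / 2)) * 2 := by gcongr
        _ = _ := by field_simp; ring
    refine (norm_add_le _ _).trans ?_
    rw [norm_mul, norm_mul, Complex.norm_I, one_mul, Complex.norm_real, Complex.norm_real,
      Real.norm_eq_abs, Real.norm_eq_abs]
    calc |(m ^ 2 - b * r) / ρ ^ 3| + ‖κ‖ * |((r - b) / ρ - 1) * (r / ρ)|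
        ≤ 16 * m / r ^ 2 + ‖κ‖ * (8 * m ^ 2 / r ^ 2) := by gcongr
      _ = (16 * m + 8 * ‖κ‖ * m ^ 2) / r ^ 2 := by ring
      _ ≤ _ := by gcongr; linarith

lemma feE_ray (κ : ℂ) {ε : ℝ} (hε : 0 < ε) {a θ : E3} (hθ : ‖θ‖ = 1) {r : ℝ}
    (hr : 2 * ‖a‖ + 1 ≤ r) (hr2 : 4 * ε ≤ r) :
    feE κ ε a (r • θ) = Complex.exp (Complex.I * κ * r) * Vr κ a θ r / r := by
  have hr0 : 0 < r := by linarith [norm_nonneg a]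
  have hlow := ray_low hθ a hr0.le
  have h2 : 2 ≤ ‖r • θ - a‖ / ε := (le_div_iff₀ hε).2 (by linarith)
  have hρ0 : 0 < ‖r • θ - a‖ := by linarith
  have hrc : (r : ℂ) ≠ 0 := by exact_mod_cast hr0.ne'
  have hρc : (‖r • θ - a‖ : ℂ) ≠ 0 := by exact_mod_cast hρ0.ne'
  rw [feE, fe, st_one h2, Vr]
  have : Complex.exp (Complex.I * κ * (‖r • θ - a‖ : ℂ))
      = Complex.exp (Complex.I * κ * r) * Complex.exp (Complex.I * κ * ((‖r • θ - a‖ - r : ℝ) : ℂ)) := by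
    rw [← Complex.exp_add]; congr 1; push_cast; ring
  rw [this]
  field_simp

/-- radius threshold -/
def R00 (ε h : ℝ) (p : ℝ × ℝ) : ℝ :=
  2 * ‖pt3 p.1 p.2 (-h)‖ + 2 * ‖pt3 p.1 p.2 h‖ + 4 * ε + 2

def V2 (κ : ℂ) (h : ℝ) (p : ℝ × ℝ) (θ : E3) (r : ℝ) : ℂ :=
  Vr κ (pt3 p.1 p.2 (-h)) θ r - Vr κ (pt3 p.1 p.2 h) θ r
def V2' (κ : ℂ) (h : ℝ) (p : ℝ × ℝ) (θ : E3) (r : ℝ) : ℂ :=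
  Vr' κ (pt3 p.1 p.2 (-h)) θ r - Vr' κ (pt3 p.1 p.2 h) θ r

lemma V2_bounds (κ : ℂ) (hκ : 0 ≤ κ.im) {ε : ℝ} (hε : 0 < ε) (h : ℝ) (p : ℝ × ℝ) :
    ∃ A : ℝ, 0 < A ∧ ∀ θ : E3, ‖θ‖ = 1 →
    ∀ r : ℝ, R00 ε h p ≤ r → ‖V2 κ h p θ r‖ ≤ A ∧ ‖V2' κ h p θ r‖ ≤ A / r ^ 2 ∧
      HasDerivAt (V2 κ h p θ) (V2' κ h p θ r) r := by
  obtain ⟨A, hA, h1⟩ := Vr_bounds κ hκ (pt3 p.1 p.2 (-h))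
  obtain ⟨B, hB, h2⟩ := Vr_bounds κ hκ (pt3 p.1 p.2 h)
  refine ⟨A + B, by positivity, fun θ hθ r hr => ?_⟩
  unfold R00 at hr
  have n1 := norm_nonneg (pt3 p.1 p.2 (-h))
  have n2 := norm_nonneg (pt3 p.1 p.2 h)
  have g1 := h1 θ hθ r (by linarith)
  have g2 := h2 θ hθ r (by linarith)
  refine ⟨(norm_sub_le _ _).trans (add_le_add g1.1 g2.1), ?_, ?_⟩
  · rw [add_div]
    exact (norm_sub_le _ _).trans (add_le_add g1.2 g2.2)
  · exact (Vr_hasDerivAt κ hθ (by linarith)).sub (Vr_hasDerivAt κ hθ (by linarith))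

lemma Er_ray (κ : ℂ) (hκ : 0 ≤ κ.im) {ε : ℝ} (hε : 0 < ε) (h : ℝ) (p : ℝ × ℝ) {R : ℝ} (hR : 0 < R)
    {θ : E3} (hθ : ‖θ‖ = 1) {r : ℝ} (hr : R00 ε h p + 1 ≤ r) :
    ((r ^ 2 : ℝ) : ℂ) * Er κ R (uE κ ε h p) (r • θ) =
      r * (2 * (-(st1 (r / R) / R)) * (Complex.exp (Complex.I * κ * r) *
          (Complex.I * κ * V2 κ h p θ r + V2' κ h p θ r))
        + (-(st2 (r / R) / R / R)) * (Complex.exp (Complex.I * κ * r) * V2 κ h p θ r)) := by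
  have hR0 : 0 ≤ R00 ε h p := by unfold R00; positivity
  have hr0 : 0 < r := by linarith
  have hrc : (r : ℂ) ≠ 0 := by exact_mod_cast hr0.ne'
  have hn : ‖r • θ‖ = r := by rw [norm_smul, hθ, mul_one, Real.norm_eq_abs, abs_of_pos hr0]
  have hne : r • θ ≠ 0 := by rw [← norm_ne_zero_iff, hn]; exact hr0.ne'
  have hu := uE_contDiff κ hε h p
  have hur : ∀ s, R00 ε h p < s → uE κ ε h p (s • θ)
      = Complex.exp (Complex.I * κ * s) * V2 κ h p θ s / s := by
    intro s hs
    unfold R00 at hs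
    have n1 := norm_nonneg (pt3 p.1 p.2 (-h))
    have n2 := norm_nonneg (pt3 p.1 p.2 h)
    rw [uE, feE_ray κ hε hθ (by linarith) (by linarith), feE_ray κ hε hθ (by linarith) (by linarith),
      V2]
    ring
  obtain ⟨A, hA, hV⟩ := V2_bounds κ hκ hε h p
  have hl : HasDerivAt (fun t : ℝ => t • θ) θ r := by
    simpa using (hasDerivAt_id r).smul_const θ
  have d1 : HasDerivAt (fun t : ℝ => uE κ ε h p (t • θ)) (fderiv ℝ (uE κ ε h p) (r • θ) θ) r := by
    have hh := ((hu.differentiable (by simp)) (r • θ)).hasFDerivAt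
    exact hh.comp_hasDerivAt r hl
  have d2 := ((exp_hasDerivAt κ r).mul (hV θ hθ r (by linarith)).2.2).div
    (HasDerivAt.ofReal_comp (hasDerivAt_id r)) hrc
  have d3 := d2.congr_of_eventuallyEq (f₁ := fun t : ℝ => uE κ ε h p (t • θ)) (by
    filter_upwards [Ioi_mem_nhds (show R00 ε h p < r by linarith)] with s hs
    exact hur s hs)
  have hf := d1.unique d3
  have hc := cut_lap κ hR hu (r • θ) hne
  rw [Er, hc, hn, map_smul, hf, hur r (by linarith), Complex.real_smul]
  simp only [id, Pi.mul_apply, Complex.ofReal_one]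
  push_cast
  field_simp
  ring

lemma Er_ray_zero (κ : ℂ) {u : E3 → ℂ} (hu : ContDiff ℝ 2 u) {R : ℝ} (hR : 0 < R)
    {y : E3} (hy : y ≠ 0) (hr : ‖y‖ < R ∨ 2 * R < ‖y‖) : Er κ R u y = 0 := by
  rw [Er, cut_lap κ hR hu y hy]
  rcases hr with hr | hr
  · have : ‖y‖ / R ≤ 1 := (div_le_one hR).2 hr.le
    rw [st1_left this, st2_left this]; simp
  · have : 2 ≤ ‖y‖ / R := (le_div_iff₀ hR).2 hr.le
    rw [st1_right this, st2_right this]; simp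

end Part7

section Part8

open MeasureTheory Filter Topology



lemma half_polar {F : E3 → ℂ} {η : ℝ} (hη : 0 ≤ η)
    (hF : ∀ θ : E3, ‖θ‖ = 1 → θ 2 < 0 →
      ‖∫ r in Set.Ioi (0:ℝ), ((r ^ 2 : ℝ) : ℂ) * F (r • θ)‖ ≤ η) :
    ‖∫ y in {y : E3 | y 2 < 0}, F y‖ ≤ sphC * η := by
  rw [← integral_indicator isOpen_half.measurableSet]
  refine polar_bound hη fun θ hθ => ?_
  by_cases h : θ 2 < 0
  · refine le_of_eq_of_le ?_ (hF θ hθ h)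
    congr 1
    refine setIntegral_congr_fun measurableSet_Ioi fun r hr => ?_
    have : r • θ ∈ {y : E3 | y 2 < 0} := by
      show (r • θ) 2 < 0
      simp only [PiLp.smul_apply, smul_eq_mul]
      exact mul_neg_of_pos_of_neg hr h
    simp only [Set.indicator_of_mem this]
  · refine le_of_eq_of_le ?_ hη
    rw [norm_eq_zero]
    refine setIntegral_eq_zero_of_forall_eq_zero fun r hr => ?_
    have : r • θ ∉ {y : E3 | y 2 < 0} := by
      show ¬ (r • θ) 2 < 0
      simp only [PiLp.smul_apply, smul_eq_mul]
      push Not at h ⊢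
      exact mul_nonneg (le_of_lt hr) h
    simp only [Set.indicator_of_notMem this, mul_zero]

lemma ray_cont {w : E3 → ℂ} (hwc : ContinuousOn w {x : E3 | x 2 ≤ 0}) (κ : ℂ) {R : ℝ} (hR : 0 < R)
    {u : E3 → ℂ} (hu : ContDiff ℝ 2 u) {θ : E3} (hθ : θ 2 < 0) :
    ContinuousOn (fun r : ℝ => ((r ^ 2 : ℝ) : ℂ) * (w (r • θ) * Er κ R u (r • θ))) (Set.Ioi 0) := by
  have h1 : ContinuousOn (fun r : ℝ => w (r • θ)) (Set.Ioi 0) := by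
    refine hwc.comp (by fun_prop) fun r hr => ?_
    show (r • θ) 2 ≤ 0
    simp only [PiLp.smul_apply, smul_eq_mul]
    exact (mul_neg_of_pos_of_neg hr hθ).le
  have h2 : Continuous (fun r : ℝ => Er κ R u (r • θ)) :=
    (Er_continuous κ hR hu).comp (by fun_prop)
  have h3 : Continuous (fun r : ℝ => ((r ^ 2 : ℝ) : ℂ)) := by fun_prop
  exact h3.continuousOn.mul (h1.mul h2.continuousOn)

lemma ray_zero (w : E3 → ℂ) (κ : ℂ) {R : ℝ} (hR : 0 < R)
    {u : E3 → ℂ} (hu : ContDiff ℝ 2 u) {θ : E3} (hθ : ‖θ‖ = 1) (r : ℝ) (hr0 : 0 < r)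
    (hr : r < R ∨ 2 * R < r) :
    ((r ^ 2 : ℝ) : ℂ) * (w (r • θ) * Er κ R u (r • θ)) = 0 := by
  have hn : ‖r • θ‖ = r := by rw [norm_smul, hθ, mul_one, Real.norm_eq_abs, abs_of_pos hr0]
  have hne : r • θ ≠ 0 := by rw [← norm_ne_zero_iff, hn]; exact hr0.ne'
  rw [Er_ray_zero κ hu hR hne (by rwa [hn])]
  simp

theorem err_decay (κ : ℂ) (hκ : 0 < κ.im) {w : E3 → ℂ}
    (hwc : ContinuousOn w {x : E3 | x 2 ≤ 0}) (hw1 : ∀ x : E3, x 2 ≤ 0 → ‖w x‖ ≤ 1)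
    {ε : ℝ} (hε : 0 < ε) (h : ℝ) (p : ℝ × ℝ) :
    Tendsto (fun R => ∫ y in {y : E3 | y 2 < 0}, w y * Er κ R (uE κ ε h p) y) atTop (𝓝 0) := by
  obtain ⟨A, hA, hV⟩ := V2_bounds κ hκ.le hε h p
  obtain ⟨C, hC, hst⟩ := st_bounds
  have hu := uE_contDiff κ hε h p
  set K : ℝ := 2 * (2 * C * (‖κ‖ + 1) * A + C * A) with hK
  have key : ∀ᶠ R : ℝ in atTop, ‖∫ y in {y : E3 | y 2 < 0}, w y * Er κ R (uE κ ε h p) y‖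
      ≤ sphC * (K * (R * Real.exp (-(κ.im) * R))) := by
    filter_upwards [eventually_ge_atTop (R00 ε h p + 1), eventually_ge_atTop 1] with R hR hR1
    have hR0 : 0 < R := by linarith
    refine half_polar (by positivity) fun θ hθ hθ2 => ?_
    refine ray_abs (P := fun _ => 0) (P' := fun _ => 0) hR0 (ray_cont hwc κ hR0 hu hθ2)
      (fun r _ => hasDerivAt_const _ _) rfl rfl ?_ (ray_zero w κ hR0 hu hθ)
    intro r hr
    have hr0 : 0 < r := lt_of_lt_of_le hR0 hr.1
    have e : ((r ^ 2 : ℝ) : ℂ) * (w (r • θ) * Er κ R (uE κ ε h p) (r • θ))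
        = w (r • θ) * (((r ^ 2 : ℝ) : ℂ) * Er κ R (uE κ ε h p) (r • θ)) := by ring
    rw [sub_zero, e, Er_ray κ hκ.le hε h p hR0 hθ (hR.trans hr.1), norm_mul]
    obtain ⟨b1, b2, -⟩ := hV θ hθ r (by linarith [hr.1])
    have b2' : ‖V2' κ h p θ r‖ ≤ A := b2.trans (div_le_self hA.le (by nlinarith [hr.1]))
    have bw : ‖w (r • θ)‖ ≤ 1 := by
      apply hw1
      simp only [PiLp.smul_apply, smul_eq_mul]
      exact (mul_neg_of_pos_of_neg hr0 hθ2).le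
    have be : ‖Complex.exp (Complex.I * κ * r)‖ ≤ Real.exp (-(κ.im) * R) := by
      rw [Complex.norm_exp]
      apply Real.exp_le_exp.2
      have : (Complex.I * κ * (r:ℂ)).re = - (κ.im * r) := by
        simp [Complex.mul_re, Complex.mul_im]
      rw [this]
      nlinarith [hr.1]
    set e := Complex.exp (Complex.I * κ * r) with he
    set E := Real.exp (-(κ.im) * R) with hE
    have hE0 : 0 < E := Real.exp_pos _
    have c1 : ‖-(st1 (r / R) / (R:ℂ))‖ ≤ C / R := by
      rw [norm_neg, norm_div, Complex.norm_real, Real.norm_eq_abs, abs_of_pos hR0]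
      gcongr; exact (hst _).1
    have c2 : ‖-(st2 (r / R) / (R:ℂ) / (R:ℂ))‖ ≤ C / R := by
      rw [norm_neg, norm_div, norm_div, Complex.norm_real, Real.norm_eq_abs, abs_of_pos hR0]
      refine (div_le_self (by positivity) hR1).trans ?_
      gcongr; exact (hst _).2
    have hr2 : ‖(r:ℂ)‖ ≤ 2 * R := by
      rw [Complex.norm_real, Real.norm_eq_abs, abs_of_pos hr0]; exact hr.2
    have f1 : ‖Complex.I * κ * V2 κ h p θ r + V2' κ h p θ r‖ ≤ (‖κ‖ + 1) * A := by
      refine (norm_add_le _ _).trans ?_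
      rw [norm_mul, norm_mul, Complex.norm_I, one_mul, add_mul, one_mul]
      gcongr
    have f2 : ‖2 * (-(st1 (r / R) / (R:ℂ))) * (e * (Complex.I * κ * V2 κ h p θ r + V2' κ h p θ r))
        + (-(st2 (r / R) / (R:ℂ) / (R:ℂ))) * (e * V2 κ h p θ r)‖
        ≤ 2 * (C / R) * (E * ((‖κ‖ + 1) * A)) + (C / R) * (E * A) := by
      refine (norm_add_le _ _).trans ?_
      rw [norm_mul, norm_mul, norm_mul, norm_mul, norm_mul, Complex.norm_ofNat]
      gcongr
    rw [norm_mul]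
    calc ‖w (r • θ)‖ * (‖(r:ℂ)‖ * _)
        ≤ 1 * ((2 * R) * (2 * (C / R) * (E * ((‖κ‖ + 1) * A)) + (C / R) * (E * A))) := by
          gcongr
      _ = K * (R * E) / R := by
          rw [hK]; field_simp
  have hlim : Tendsto (fun R : ℝ => sphC * (K * (R * Real.exp (-(κ.im) * R)))) atTop (𝓝 0) := by
    have : Tendsto (fun R : ℝ => R * Real.exp (-(κ.im) * R)) atTop (𝓝 0) := by
      simpa using tendsto_rpow_mul_exp_neg_mul_atTop_nhds_zero 1 κ.im hκ
    simpa using (this.const_mul K).const_mul sphC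
  exact squeeze_zero_norm' key hlim

theorem err_rad {k : ℝ} (hk : 0 < k) {w : E3 → ℂ}
    (hwc : ContinuousOn w {x : E3 | x 2 ≤ 0})
    (hw : ContDiffOn ℝ 2 w {x : E3 | x 2 < 0})
    (hw_rad : ∀ ε > (0 : ℝ), ∃ R : ℝ, ∀ x : E3, x 2 ≤ 0 → R ≤ ‖x‖ →
      ‖x‖ * ‖fderiv ℝ w x (‖x‖⁻¹ • x) - Complex.I * (k : ℂ) * w x‖ ≤ ε)
    {ε : ℝ} (hε : 0 < ε) (h : ℝ) (p : ℝ × ℝ) :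
    Tendsto (fun R => ∫ y in {y : E3 | y 2 < 0}, w y * Er k R (uE k ε h p) y) atTop (𝓝 0) := by
  have hκ : 0 ≤ (k:ℂ).im := by simp
  obtain ⟨A, hA, hV⟩ := V2_bounds (k:ℂ) hκ hε h p
  obtain ⟨C, hC, hst⟩ := st_bounds
  have hu := uE_contDiff (k:ℂ) hε h p
  set c : ℂ := 1 / (2 * Complex.I * k) with hc
  have hkc : (k:ℂ) ≠ 0 := by exact_mod_cast hk.ne'
  set K : ℝ := A * C * (26 + 9 * ‖c‖) with hK
  have hK0 : 0 < K := by positivity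
  have key : ∀ δ : ℝ, 0 < δ → ∀ᶠ R : ℝ in atTop,
      ‖∫ y in {y : E3 | y 2 < 0}, w y * Er k R (uE k ε h p) y‖ ≤ sphC * (K * δ) := by
    intro δ hδ
    obtain ⟨R1, hR1⟩ := hw_rad δ hδ
    set R2 := max R1 1 with hR2
    have hR21 : 1 ≤ R2 := le_max_right _ _
    obtain ⟨B, hB, hwB⟩ := half_bound hwc R2
    filter_upwards [eventually_ge_atTop (R00 ε h p + 1), eventually_ge_atTop R2,
      eventually_ge_atTop (B / δ)] with R hR hRR2 hRB
    have hR1' : 1 ≤ R := hR21.trans hRR2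
    have hR0 : 0 < R := by linarith
    refine half_polar (by positivity) fun θ hθ hθ2 => ?_
    have hhalf : ∀ r : ℝ, 0 < r → (r • θ) 2 < 0 := fun r hr => by
      simp only [PiLp.smul_apply, smul_eq_mul]
      exact (mul_neg_of_pos_of_neg hr hθ2)
    have hn : ∀ r : ℝ, 0 < r → ‖r • θ‖ = r := fun r hr0 => by
      rw [norm_smul, hθ, mul_one, Real.norm_eq_abs, abs_of_pos hr0]
    have hW : ∀ r : ℝ, 0 < r → HasDerivAt (fun t : ℝ => w (t • θ)) (fderiv ℝ w (r • θ) θ) r := by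
      intro r hr
      have hl : HasDerivAt (fun t : ℝ => t • θ) θ r := by
        simpa using (hasDerivAt_id r).smul_const θ
      have hh := ((hw.contDiffAt (isOpen_half.mem_nhds (hhalf r hr))).differentiableAt
        (by simp)).hasFDerivAt
      exact hh.comp_hasDerivAt r hl
    have hD : ∀ r : ℝ, R2 ≤ r → ‖fderiv ℝ w (r • θ) θ - Complex.I * k * w (r • θ)‖ ≤ δ / r := by
      intro r hr
      have hr0 : 0 < r := by linarith
      have := hR1 (r • θ) (hhalf r hr0).le (by rw [hn r hr0]; exact (le_max_left _ _).trans hr)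
      rw [hn r hr0, smul_smul, inv_mul_cancel₀ hr0.ne', one_smul] at this
      rw [le_div_iff₀ hr0]; linarith
    have hnexp : ∀ r : ℝ, ‖Complex.exp (Complex.I * k * r)‖ = 1 := by
      intro r
      rw [show Complex.I * k * r = ((k * r : ℝ) : ℂ) * Complex.I by push_cast; ring]
      exact Complex.norm_exp_ofReal_mul_I _
    have hnexp' : ∀ r : ℝ, ‖Complex.exp (Complex.I * (-k : ℂ) * r)‖ = 1 := by
      intro r
      rw [show Complex.I * (-k : ℂ) * r = ((-k * r : ℝ) : ℂ) * Complex.I by push_cast; ring]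
      exact Complex.norm_exp_ofReal_mul_I _
    have hWb : ∀ r : ℝ, R ≤ r → ‖w (r • θ)‖ ≤ 2 * δ * r := by
      intro r hr
      have hg : ∀ s ∈ Set.Icc R2 r, HasDerivWithinAt
          (fun t : ℝ => Complex.exp (Complex.I * (-k : ℂ) * t) * w (t • θ))
          (Complex.exp (Complex.I * (-k : ℂ) * s) *
            (fderiv ℝ w (s • θ) θ - Complex.I * k * w (s • θ))) (Set.Icc R2 r) s := by
        intro s hs
        have hs0 : 0 < s := by linarith [hs.1]
        refine (((exp_hasDerivAt (-k : ℂ) s).mul (hW s hs0)).congr_deriv ?_).hasDerivWithinAt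
        ring
      have := norm_image_sub_le_of_norm_deriv_le_segment' hg (C := δ) (fun s hs => by
        rw [norm_mul, hnexp', one_mul]
        exact (hD s hs.1).trans (div_le_self hδ.le (hR21.trans hs.1))) r ⟨hRR2.trans hr, le_refl _⟩
      have h1 := norm_le_norm_add_norm_sub' (Complex.exp (Complex.I * (-k : ℂ) * r) * w (r • θ))
        (Complex.exp (Complex.I * (-k : ℂ) * R2) * w (R2 • θ))
      rw [norm_mul, norm_mul, hnexp', hnexp', one_mul, one_mul] at h1
      have h2 := hwB (R2 • θ) (hhalf R2 (by linarith)).le (hn R2 (by linarith)).le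
      have h3 : B ≤ R * δ := (div_le_iff₀ hδ).1 hRB
      nlinarith
    refine ray_abs
      (P := fun r => Complex.exp (Complex.I * k * r) * w (r • θ) * V2 k h p θ r *
        (-(st1 (r / R) / (R : ℂ))) * ((r : ℂ) - c))
      (P' := fun r => ((((Complex.I * k * Complex.exp (Complex.I * k * r)) * w (r • θ)
          + Complex.exp (Complex.I * k * r) * fderiv ℝ w (r • θ) θ) * V2 k h p θ r
          + Complex.exp (Complex.I * k * r) * w (r • θ) * V2' k h p θ r) * (-(st1 (r / R) / (R : ℂ)))
          + Complex.exp (Complex.I * k * r) * w (r • θ) * V2 k h p θ r * (-(st2 (r / R) / R / R)))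
          * ((r : ℂ) - c)
          + Complex.exp (Complex.I * k * r) * w (r • θ) * V2 k h p θ r *
            (-(st1 (r / R) / (R : ℂ))) * 1)
      hR0 (ray_cont hwc k hR0 hu hθ2) ?_ ?_ ?_ ?_ (ray_zero w k hR0 hu hθ)
    · intro r hr
      have hr0 : 0 < r := lt_of_lt_of_le hR0 hr.1
      have hid : HasDerivAt (fun t : ℝ => (t : ℂ)) 1 r := by
        simpa using (HasDerivAt.ofReal_comp (hasDerivAt_id r))
      exact ((((exp_hasDerivAt (k : ℂ) r).mul (hW r hr0)).mul
        (hV θ hθ r (by linarith [hr.1])).2.2).mul (chi1_hasDerivAt R r)).mul (hid.sub_const c)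
    · rw [div_self hR0.ne', st1_left le_rfl]; simp
    · rw [mul_div_cancel_right₀ _ hR0.ne', st1_right le_rfl]; simp
    · intro r hr
      have hr0 : 0 < r := lt_of_lt_of_le hR0 hr.1
      have e : ((r ^ 2 : ℝ) : ℂ) * (w (r • θ) * Er k R (uE k ε h p) (r • θ))
          = w (r • θ) * (((r ^ 2 : ℝ) : ℂ) * Er k R (uE k ε h p) (r • θ)) := by ring
      rw [e, Er_ray (k:ℂ) hκ hε h p hR0 hθ (hR.trans hr.1)]
      obtain ⟨b1, b2, -⟩ := hV θ hθ r (by linarith [hr.1])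
      have b2' : ‖V2' k h p θ r‖ ≤ A / R ^ 2 := b2.trans (by gcongr; exact hr.1)
      have bw : ‖w (r • θ)‖ ≤ 4 * δ * R := (hWb r hr.1).trans (by nlinarith [hr.2])
      have be := hnexp r
      have bD : ‖fderiv ℝ w (r • θ) θ - Complex.I * k * w (r • θ)‖ ≤ δ / R :=
        (hD r (hRR2.trans hr.1)).trans (by gcongr; exact hr.1)
      have c1 : ‖-(st1 (r / R) / (R:ℂ))‖ ≤ C / R := by
        rw [norm_neg, norm_div, Complex.norm_real, Real.norm_eq_abs, abs_of_pos hR0]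
        gcongr; exact (hst _).1
      have c2 : ‖-(st2 (r / R) / (R:ℂ) / (R:ℂ))‖ ≤ C / R ^ 2 := by
        rw [norm_neg, norm_div, norm_div, Complex.norm_real, Real.norm_eq_abs, abs_of_pos hR0,
          div_div, ← sq]
        gcongr; exact (hst _).2
      have hr2 : ‖(r:ℂ)‖ ≤ 2 * R := by
        rw [Complex.norm_real, Real.norm_eq_abs, abs_of_pos hr0]; exact hr.2
      have hrc : ‖(r:ℂ) - c‖ ≤ (2 + ‖c‖) * R := by
        refine (norm_sub_le _ _).trans ?_
        nlinarith [norm_nonneg c]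
      have hcc : c * (2 * Complex.I * k) = 1 := by
        rw [hc]; field_simp
      generalize hE' : Complex.exp (Complex.I * k * r) = E at *
      generalize hW1' : fderiv ℝ w (r • θ) θ = W1 at *
      generalize hW0' : w (r • θ) = W at *
      generalize hV1' : V2' k h p θ r = V1 at *
      generalize hV0' : V2 k h p θ r = V at *
      generalize hx1 : -(st1 (r / R) / (R:ℂ)) = x1 at *
      generalize hx2 : -(st2 (r / R) / (R:ℂ) / (R:ℂ)) = x2 at *
      have hid : W * (r * (2 * x1 * (E * (Complex.I * k * V + V1)) + x2 * (E * V)))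
          - (((((Complex.I * k * E) * W + E * W1) * V + E * W * V1) * x1 + E * W * V * x2) * ((r:ℂ) - c)
            + E * W * V * x1 * 1)
          = E * (2 * r * x1 * W * V1 - (W1 - Complex.I * k * W) * V * x1 * ((r:ℂ) - c)
            - W * V1 * x1 * ((r:ℂ) - c) + c * W * V * x2) := by
        linear_combination (E * W * V * x1) * hcc
      rw [hid, norm_mul, be, one_mul]
      calc _ ≤ ‖2 * r * x1 * W * V1‖ + ‖(W1 - Complex.I * k * W) * V * x1 * ((r:ℂ) - c)‖
            + ‖W * V1 * x1 * ((r:ℂ) - c)‖ + ‖c * W * V * x2‖ := by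
            refine (norm_add_le _ _).trans ?_
            gcongr
            refine (norm_sub_le _ _).trans ?_
            gcongr
            exact norm_sub_le _ _
        _ ≤ 2 * (2 * R) * (C / R) * (4 * δ * R) * (A / R ^ 2)
            + (δ / R) * A * (C / R) * ((2 + ‖c‖) * R)
            + (4 * δ * R) * (A / R ^ 2) * (C / R) * ((2 + ‖c‖) * R)
            + ‖c‖ * (4 * δ * R) * A * (C / R ^ 2) := by
            simp only [norm_mul, Complex.norm_ofNat] at *
            gcongr
        _ = K * δ / R := by
            rw [hK]; field_simp; ring
  rw [Metric.tendsto_nhds]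
  intro η hη
  have hs : 0 < sphC + 1 := by linarith [sphC_nonneg]
  filter_upwards [key (η / (2 * ((sphC + 1) * K))) (by positivity)] with R hR
  rw [dist_zero_right]
  refine lt_of_le_of_lt hR ?_
  have : sphC * (K * (η / (2 * ((sphC + 1) * K)))) = (sphC / (sphC + 1)) * (η / 2) := by
    field_simp
  rw [this]
  have : sphC / (sphC + 1) ≤ 1 := by rw [div_le_one hs]; linarith
  nlinarith

end Part8

section Part9

open MeasureTheory Filter Topology



/-- normalising constant -/
def cst : ℂ := ∫ z : E3, st2 ‖z‖ / ‖z‖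

lemma cst_ne : cst ≠ 0 := by
  have h1 := integral_fun_norm_addHaar (volume : Measure E3) (fun r : ℝ => st2 r / (r : ℂ))
  have h2 : ∫ y in Set.Ioi (0 : ℝ), y ^ (Module.finrank ℝ E3 - 1) • (st2 y / (y : ℂ)) = -1 := by
    have hd : Module.finrank ℝ E3 = 3 := by simp
    rw [hd]
    have e1 : ∫ y in Set.Ioi (0 : ℝ), y ^ (3 - 1) • (st2 y / (y : ℂ))
        = ∫ y in Set.Ioi (0 : ℝ), y * st2 y := by
      refine setIntegral_congr_fun measurableSet_Ioi fun y hy => ?_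
      have : (y : ℂ) ≠ 0 := by exact_mod_cast (ne_of_gt hy)
      simp only [Complex.real_smul]
      push_cast
      field_simp
    have e2 : ∫ y in Set.Ioi (0 : ℝ), (y : ℂ) * st2 y = ∫ y in (1:ℝ)..2, (y : ℂ) * st2 y := by
      rw [intervalIntegral.integral_of_le (by norm_num)]
      refine (setIntegral_eq_of_subset_of_forall_sdiff_eq_zero measurableSet_Ioi ?_ ?_)
      · intro r hr; exact lt_trans one_pos hr.1
      · intro r hr
        rcases le_or_gt r 1 with h | h
        · rw [st2_left h, mul_zero]
        · rcases le_or_gt 2 r with h' | h'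
          · rw [st2_right h', mul_zero]
          · exact absurd ⟨h, h'.le⟩ hr.2
    rw [e1, e2]
    have hc : Continuous fun y : ℝ => (y : ℂ) * st2 y := by
      have := st2_continuous
      fun_prop
    rw [intervalIntegral.integral_eq_sub_of_hasDerivAt (f := fun y : ℝ => (y:ℂ) * st1 y - st y)]
    · rw [st1_right le_rfl, st1_left le_rfl, st_one le_rfl, st_zero le_rfl]; simp
    · intro y _
      have hid : HasDerivAt (fun t : ℝ => (t : ℂ)) 1 y := by
        simpa using (HasDerivAt.ofReal_comp (hasDerivAt_id y))
      refine ((hid.mul (st1_hasDerivAt y)).sub (st_hasDerivAt y)).congr_deriv ?_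
      ring
    · exact hc.intervalIntegrable _ _
  rw [cst, h1, h2]
  have hb : (volume : Measure E3).real (Metric.ball 0 1) ≠ 0 := by
    have := Metric.measure_ball_pos (volume : Measure E3) 0 one_pos
    have h3 : (volume : Measure E3) (Metric.ball 0 1) ≠ ⊤ := measure_ball_lt_top.ne
    rw [Measure.real]
    exact (ENNReal.toReal_pos this.ne' h3).ne'
  simp [hb]

lemma chi_norm (R r : ℝ) : ‖chi R r‖ ≤ 2 := by
  unfold chi
  refine (norm_sub_le _ _).trans ?_
  rw [norm_one]
  linarith [st_norm (r / R)]

theorem src_limit (κ : ℂ) {w : E3 → ℂ} (hwc : ContinuousOn w {x : E3 | x 2 ≤ 0})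
    {x : E3} {h : ℝ} (hh : 0 < h) (hx : x 2 = -h) :
    Tendsto (fun ε : ℝ => ∫ y in {y : E3 | y 2 < 0}, w y * src κ ε ‖y - x‖) (𝓝[>] 0)
      (𝓝 (cst * w x)) := by
  obtain ⟨C, hC, hst⟩ := st_bounds
  obtain ⟨M, hM, hwM⟩ := half_bound hwc (‖x‖ + h)
  set F : ℝ → E3 → ℂ := fun ε => Set.indicator {y : E3 | y 2 < 0} fun y => w y * src κ ε ‖y - x‖
    with hF
  have hFi : ∀ ε, 0 < ε → Integrable (F ε) := by
    intro ε hε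
    rw [hF, integrable_indicator_iff isOpen_half.measurableSet]
    refine half_integrable hwc (src_continuous κ hε _) (L := ‖x‖ + 2 * ε) fun y hy => ?_
    apply src_zero' κ hε
    have := norm_le_norm_add_norm_sub' y x
    linarith
  have hres : ∀ ε, 0 < ε → ∫ y in {y : E3 | y 2 < 0}, w y * src κ ε ‖y - x‖
      = ∫ z, (ε : ℂ) ^ 3 * F ε (x + ε • z) := by
    intro ε hε
    rw [← integral_indicator isOpen_half.measurableSet]
    change ∫ y, F ε y = _
    rw [integral_const_mul, Measure.integral_comp_smul volume (fun z => F ε (x + z)) ε,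
      integral_add_left_eq_self (F ε) x]
    have hd : Module.finrank ℝ E3 = 3 := by simp
    rw [hd, Complex.real_smul, abs_of_pos (by positivity)]
    have : (ε : ℂ) ≠ 0 := by exact_mod_cast hε.ne'
    push_cast
    field_simp
  have hev : ∀ᶠ ε : ℝ in 𝓝[>] 0, 0 < ε ∧ ε ≤ h / 4 := by
    filter_upwards [self_mem_nhdsWithin, mem_nhdsWithin_of_mem_nhds
      (Iic_mem_nhds (show (0:ℝ) < h / 4 by linarith))] with ε h1 h2
    exact ⟨h1, h2⟩
  have hform : ∀ ε, 0 < ε → ε ≤ h / 4 → ∀ z : E3, (ε : ℂ) ^ 3 * F ε (x + ε • z)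
      = w (x + ε • z) * ((st2 ‖z‖ + 2 * Complex.I * κ * ε * st1 ‖z‖)
          * Complex.exp (Complex.I * κ * ((ε * ‖z‖ : ℝ) : ℂ)) / ‖z‖) := by
    intro ε hε hε2 z
    have hεc : (ε : ℂ) ≠ 0 := by exact_mod_cast hε.ne'
    have hn : ‖x + ε • z - x‖ = ε * ‖z‖ := by
      rw [add_sub_cancel_left, norm_smul, Real.norm_eq_abs, abs_of_pos hε]
    have hs : src κ ε (ε * ‖z‖) * (ε : ℂ) ^ 3 = (st2 ‖z‖ + 2 * Complex.I * κ * ε * st1 ‖z‖)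
          * Complex.exp (Complex.I * κ * ((ε * ‖z‖ : ℝ) : ℂ)) / ‖z‖ := by
      rw [src, mul_div_cancel_left₀ _ hε.ne']
      push_cast
      by_cases hz : (‖z‖ : ℂ) = 0
      · simp [hz]
      field_simp
    rw [← hs]
    rcases le_or_gt 2 ‖z‖ with h2 | h2
    · have : src κ ε (ε * ‖z‖) = 0 := src_zero' κ hε (by nlinarith)
      simp only [hF, Set.indicator, hn, this, mul_zero, zero_mul, ite_self]
    · have hmem : x + ε • z ∈ {y : E3 | y 2 < 0} := by
        show (x + ε • z) 2 < 0
        simp only [PiLp.add_apply, PiLp.smul_apply, smul_eq_mul, hx]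
        have h3 := (le_abs_self _).trans (abs_coord_le z 2)
        nlinarith
      simp only [hF]
      rw [Set.indicator_of_mem hmem, hn]
      ring
  have key : Tendsto (fun ε : ℝ => ∫ z, (ε : ℂ) ^ 3 * F ε (x + ε • z)) (𝓝[>] 0)
      (𝓝 (∫ z : E3, w x * (st2 ‖z‖ / ‖z‖))) := by
    refine tendsto_integral_filter_of_dominated_convergence
      (Set.indicator (Metric.closedBall (0:E3) 2)
        fun _ => M * ((C + 2 * ‖κ‖ * h * C) * Real.exp (‖κ‖ * h))) ?_ ?_ ?_ ?_
    · filter_upwards [hev] with ε hε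
      exact ((((hFi ε hε.1).comp_add_left x).comp_smul hε.1.ne').const_mul _).aestronglyMeasurable
    · filter_upwards [hev] with ε hε
      refine Eventually.of_forall fun z => ?_
      rw [hform ε hε.1 hε.2]
      have hε0 := hε.1
      have hε2 := hε.2
      by_cases hz2 : z ∈ Metric.closedBall (0:E3) 2
      · rw [Set.indicator_of_mem hz2]
        have hz2' : ‖z‖ ≤ 2 := by simpa using hz2
        rcases le_or_gt ‖z‖ 1 with h1 | h1
        · rw [st1_left h1, st2_left h1]
          simp
          positivity
        · have hw1 : ‖w (x + ε • z)‖ ≤ M := by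
            apply hwM
            · simp only [PiLp.add_apply, PiLp.smul_apply, smul_eq_mul, hx]
              have h3 := (le_abs_self _).trans (abs_coord_le z 2)
              nlinarith
            · refine (norm_add_le _ _).trans ?_
              rw [norm_smul, Real.norm_eq_abs, abs_of_pos hε0]
              nlinarith
          have hexp : ‖Complex.exp (Complex.I * κ * ((ε * ‖z‖ : ℝ) : ℂ))‖ ≤ Real.exp (‖κ‖ * h) := by
            refine (Complex.norm_exp_le_exp_norm _).trans (Real.exp_le_exp.2 ?_)
            rw [norm_mul, norm_mul, Complex.norm_I, one_mul, Complex.norm_real, Real.norm_eq_abs,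
              abs_of_nonneg (by positivity)]
            gcongr
            nlinarith
          have hsum : ‖st2 ‖z‖ + 2 * Complex.I * κ * ε * st1 ‖z‖‖ ≤ C + 2 * ‖κ‖ * h * C := by
            refine (norm_add_le _ _).trans ?_
            refine add_le_add (hst _).2 ?_
            rw [norm_mul, norm_mul, norm_mul, norm_mul, Complex.norm_I, Complex.norm_ofNat,
              Complex.norm_real, Real.norm_eq_abs, abs_of_pos hε0, mul_one]
            gcongr
            · linarith
            · exact (hst _).1
          rw [norm_mul, norm_div, norm_mul, Complex.norm_real, norm_norm]
          gcongr
          refine (div_le_self (by positivity) h1.le).trans ?_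
          gcongr
      · rw [Set.indicator_of_notMem hz2]
        have hz2' : 2 < ‖z‖ := by simpa using hz2
        rw [st1_right hz2'.le, st2_right hz2'.le]
        simp
    · exact (integrable_indicator_iff Metric.isClosed_closedBall.measurableSet).2
        (integrableOn_const measure_closedBall_lt_top.ne)
    · refine Eventually.of_forall fun z => ?_
      have hlim : Tendsto (fun ε : ℝ => w (x + ε • z) *
          ((st2 ‖z‖ + 2 * Complex.I * κ * ε * st1 ‖z‖)
          * Complex.exp (Complex.I * κ * ((ε * ‖z‖ : ℝ) : ℂ)) / ‖z‖)) (𝓝[>] 0)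
          (𝓝 (w x * (st2 ‖z‖ / ‖z‖))) := by
        have hxm : {x : E3 | x 2 ≤ 0} ∈ 𝓝 x :=
          mem_of_superset (isOpen_half.mem_nhds (show x 2 < 0 by linarith)) fun y hy =>
            le_of_lt (show y 2 < 0 from hy)
        have hwx : ContinuousAt w x := hwc.continuousAt hxm
        have l0 : Tendsto (fun ε : ℝ => x + ε • z) (𝓝[>] 0) (𝓝 x) := by
          have : Continuous fun ε : ℝ => x + ε • z := by fun_prop
          have := this.tendsto 0
          simp only [zero_smul, add_zero] at this
          exact this.mono_left nhdsWithin_le_nhds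
        have l1 := hwx.tendsto.comp l0
        have l2 : Tendsto (fun ε : ℝ => (st2 ‖z‖ + 2 * Complex.I * κ * ε * st1 ‖z‖)
          * Complex.exp (Complex.I * κ * ((ε * ‖z‖ : ℝ) : ℂ)) / ‖z‖) (𝓝[>] 0)
            (𝓝 (st2 ‖z‖ / ‖z‖)) := by
          have : Continuous fun ε : ℝ => (st2 ‖z‖ + 2 * Complex.I * κ * ε * st1 ‖z‖)
            * Complex.exp (Complex.I * κ * ((ε * ‖z‖ : ℝ) : ℂ)) / ‖z‖ := by fun_prop
          have := this.tendsto 0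
          simp only [zero_mul, Complex.ofReal_zero, mul_zero, Complex.exp_zero, mul_one, add_zero]
            at this
          exact this.mono_left nhdsWithin_le_nhds
        exact l1.mul l2
      refine hlim.congr' ?_
      filter_upwards [hev] with ε hε
      rw [hform ε hε.1 hε.2]
  rw [integral_const_mul, mul_comm] at key
  refine key.congr' ?_
  filter_upwards [hev] with ε hε
  rw [hres ε hε.1]

theorem rep (κ : ℂ) {w : E3 → ℂ}
    (hwc : ContinuousOn w {x : E3 | x 2 ≤ 0})
    (hw : ContDiffOn ℝ 2 w {x : E3 | x 2 < 0})
    (hH : ∀ x : E3, x 2 < 0 → lap3 w x + κ ^ 2 * w x = 0)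
    {h : ℝ} (hh : 0 < h) (p : ℝ × ℝ)
    (herr : ∀ ε : ℝ, 0 < ε →
      Tendsto (fun R => ∫ y in {y : E3 | y 2 < 0}, w y * Er κ R (uE κ ε h p) y) atTop (𝓝 0))
    (hintg : Integrable fun q : ℝ × ℝ => w (pt3 q.1 q.2 0) * Mk κ h (p - q)) :
    cst * w (pt3 p.1 p.2 (-h)) = ∫ q : ℝ × ℝ, w (pt3 q.1 q.2 0) * Mk κ h (p - q) := by
  have hev : ∀ᶠ ε : ℝ in 𝓝[>] 0, 0 < ε ∧ ε ≤ h / 2 := by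
    filter_upwards [self_mem_nhdsWithin, mem_nhdsWithin_of_mem_nhds
      (Iic_mem_nhds (show (0:ℝ) < h / 2 by linarith))] with ε h1 h2
    exact ⟨h1, h2⟩
  have hb : Tendsto (fun R : ℝ => ∫ q : ℝ × ℝ, w (pt3 q.1 q.2 0) *
      (chiE R (pt3 q.1 q.2 0) * Mk κ h (p - q))) atTop
      (𝓝 (∫ q : ℝ × ℝ, w (pt3 q.1 q.2 0) * Mk κ h (p - q))) := by
    refine tendsto_integral_filter_of_dominated_convergence
      (fun q => 2 * ‖w (pt3 q.1 q.2 0) * Mk κ h (p - q)‖) ?_ ?_ (hintg.norm.const_mul 2) ?_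
    · filter_upwards [eventually_gt_atTop 0] with R hR
      have hc : Continuous fun q : ℝ × ℝ => chiE R (pt3 q.1 q.2 0) := by
        have : Continuous fun q : ℝ × ℝ => pt3 q.1 q.2 0 :=
          continuous_pt3.comp (by fun_prop : Continuous fun q : ℝ × ℝ => (q.1, q.2, (0:ℝ)))
        exact (chiE_contDiff hR).continuous.comp this
      have := hc.aestronglyMeasurable.mul hintg.aestronglyMeasurable
      refine this.congr (Eventually.of_forall fun q => ?_)
      simp only [Pi.mul_apply]
      ring
    · refine Eventually.of_forall fun R => Eventually.of_forall fun q => ?_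
      rw [show w (pt3 q.1 q.2 0) * (chiE R (pt3 q.1 q.2 0) * Mk κ h (p - q)) =
        chiE R (pt3 q.1 q.2 0) * (w (pt3 q.1 q.2 0) * Mk κ h (p - q)) by ring, norm_mul]
      gcongr
      exact chi_norm _ _
    · refine Eventually.of_forall fun q => ?_
      refine tendsto_const_nhds.congr' ?_
      filter_upwards [eventually_gt_atTop 0, eventually_ge_atTop ‖pt3 q.1 q.2 0‖] with R hR hR2
      rw [chiE, sub_zero, chi_one hR hR2, one_mul]
  have hconst : ∀ ε : ℝ, 0 < ε → ε ≤ h / 2 →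
      (∫ y in {y : E3 | y 2 < 0}, w y * src κ ε ‖y - pt3 p.1 p.2 (-h)‖)
        = ∫ q : ℝ × ℝ, w (pt3 q.1 q.2 0) * Mk κ h (p - q) := by
    intro ε hε hε2
    have h1 := (herr ε hε).const_add
      (∫ y in {y : E3 | y 2 < 0}, w y * src κ ε ‖y - pt3 p.1 p.2 (-h)‖)
    rw [add_zero] at h1
    refine tendsto_nhds_unique h1 (hb.congr' ?_)
    filter_upwards [eventually_ge_atTop (‖pt3 p.1 p.2 (-h)‖ + 2 * ε)] with R hR
    rw [green_cut κ hwc hw hH hε (by linarith) p hR]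
  refine tendsto_nhds_unique (src_limit κ hwc hh (pt3_apply2 p.1 p.2 (-h))) ?_
  refine tendsto_const_nhds.congr' ?_
  filter_upwards [hev] with ε hε
  rw [hconst ε hε.1 hε.2]

end Part9

section Part10

open MeasureTheory Filter Topology



lemma rho_pos {h : ℝ} (hh : 0 < h) (d : ℝ × ℝ) : 0 < rho h d := lt_of_lt_of_le hh (rho_ge d)

lemma rho_continuous (h : ℝ) : Continuous (rho h) := by
  unfold rho; fun_prop

lemma Mk_continuous (κ : ℂ) {h : ℝ} (hh : 0 < h) : Continuous (Mk κ h) := by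
  have h1 := rho_continuous h
  have h2 : ∀ d, (rho h d : ℂ) ≠ 0 := fun d => by exact_mod_cast (rho_pos hh d).ne'
  have h3 : ∀ d, (rho h d : ℂ) ^ 2 ≠ 0 := fun d => pow_ne_zero 2 (h2 d)
  unfold Mk
  fun_prop (disch := assumption)

lemma Mk_even (κ : ℂ) (h : ℝ) (d : ℝ × ℝ) : Mk κ h (-d) = Mk κ h d := by
  have : rho h (-d) = rho h d := by simp [rho]
  simp only [Mk, this]

lemma Mk_bound_exp (κ : ℂ) {h : ℝ} (hh : 0 < h) (d : ℝ × ℝ) :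
    ‖Mk κ h d‖ ≤ 2 * (‖κ‖ / h + 1 / h ^ 2) * Real.exp (-κ.im * rho h d) := by
  have h0 := rho_pos hh d
  have h1 : h ≤ rho h d := rho_ge d
  unfold Mk
  generalize rho h d = ρ at *
  have he : ‖Complex.exp (Complex.I * κ * ρ)‖ = Real.exp (-κ.im * ρ) := by
    rw [Complex.norm_exp]; congr 1
    simp [Complex.mul_re, Complex.mul_im]
  rw [norm_div, norm_mul, norm_mul, norm_mul, he, Complex.norm_ofNat, Complex.norm_real,
    Complex.norm_real, Real.norm_eq_abs, Real.norm_eq_abs, abs_of_pos hh, abs_of_pos h0]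
  have h2 : ‖Complex.I * κ / (ρ:ℂ) - 1 / (ρ:ℂ) ^ 2‖ ≤ ‖κ‖ / h + 1 / h ^ 2 := by
    refine (norm_sub_le _ _).trans ?_
    rw [norm_div, norm_div, norm_pow, norm_mul, Complex.norm_I, one_mul, norm_one, Complex.norm_real,
      Real.norm_eq_abs, abs_of_pos h0]
    gcongr
  calc 2 * h * (Real.exp (-κ.im * ρ) * ‖Complex.I * κ / (ρ:ℂ) - 1 / (ρ:ℂ) ^ 2‖) / ρ
      ≤ 2 * h * (Real.exp (-κ.im * ρ) * (‖κ‖ / h + 1 / h ^ 2)) / h := by gcongr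
    _ = _ := by field_simp

lemma Mk_bound (κ : ℂ) (hκ : 0 ≤ κ.im) {h : ℝ} (hh : 0 < h) (d : ℝ × ℝ) :
    ‖Mk κ h d‖ ≤ 2 * (‖κ‖ / h + 1 / h ^ 2) := by
  refine (Mk_bound_exp κ hh d).trans (mul_le_of_le_one_right (by positivity) ?_)
  rw [Real.exp_le_one_iff]
  nlinarith [rho_pos hh d]

lemma norm_le_rho (h : ℝ) (d : ℝ × ℝ) : ‖d‖ ≤ rho h d := by
  rw [Prod.norm_def, max_le_iff]
  constructor <;>
  · rw [Real.norm_eq_abs]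
    refine Real.le_sqrt_of_sq_le ?_
    rw [sq_abs]
    nlinarith [sq_nonneg d.1, sq_nonneg d.2, sq_nonneg h]

lemma Mk_integrable (κ : ℂ) (hκ : 0 < κ.im) {h : ℝ} (hh : 0 < h) : Integrable (Mk κ h) := by
  set s := κ.im with hs
  have hi : Integrable (fun d : ℝ × ℝ => (1 + ‖d‖) ^ (-(3:ℝ))) :=
    integrable_one_add_norm (by simp; norm_num)
  refine (hi.const_mul (2 * (‖κ‖ / h + 1 / h ^ 2) * (6 * Real.exp s / s ^ 3))).mono'
    (Mk_continuous κ hh).aestronglyMeasurable (Eventually.of_forall fun d => ?_)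
  refine (Mk_bound_exp κ hh d).trans ?_
  rw [mul_assoc (2 * (‖κ‖ / h + 1 / h ^ 2))]
  refine mul_le_mul_of_nonneg_left ?_ (by positivity)
  have hn := norm_nonneg d
  have h1 : Real.exp (-s * rho h d) ≤ Real.exp (-s * ‖d‖) := by
    apply Real.exp_le_exp.2
    nlinarith [norm_le_rho h d]
  refine h1.trans ?_
  have h2 := Real.pow_div_factorial_le_exp (s * (1 + ‖d‖)) (by positivity) 3
  have h3 : (1 + ‖d‖) ^ (-(3:ℝ)) = ((1 + ‖d‖) ^ 3)⁻¹ := by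
    rw [Real.rpow_neg (by positivity)]; norm_cast
  rw [h3]
  have h4 : Real.exp (-s * ‖d‖) * Real.exp (s * (1 + ‖d‖)) = Real.exp s := by
    rw [← Real.exp_add]; congr 1; ring
  have h5 : (s * (1 + ‖d‖)) ^ 3 / 6 ≤ Real.exp (s * (1 + ‖d‖)) := by
    simpa [Nat.factorial] using h2
  have h6 : Real.exp (-s * ‖d‖) * ((s * (1 + ‖d‖)) ^ 3 / 6) ≤ Real.exp s := by
    rw [← h4]; gcongr
  rw [← div_eq_mul_inv, div_div, le_div_iff₀ (by positivity)]
  nlinarith [h6]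

/-! ### plane waves -/

def pw (α : Fin 3 → ℂ) (y : E3) : ℂ := Complex.exp (∑ i, α i * (y i : ℂ))

lemma pw_hasFDerivAt (α : Fin 3 → ℂ) (y : E3) :
    HasFDerivAt (pw α) (pw α y • (∑ i, α i • (Complex.ofRealCLM.comp
      (EuclideanSpace.proj i : E3 →L[ℝ] ℝ)))) y := by
  have : HasFDerivAt (fun y : E3 => ∑ i, α i * (y i : ℂ))
      (∑ i, α i • (Complex.ofRealCLM.comp (EuclideanSpace.proj i : E3 →L[ℝ] ℝ))) y := by
    have := (∑ i, α i • (Complex.ofRealCLM.comp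
      (EuclideanSpace.proj i : E3 →L[ℝ] ℝ))).hasFDerivAt (x := y)
    refine this.congr_of_eventuallyEq (Eventually.of_forall fun z => ?_)
    simp
  exact this.cexp

lemma pw_dd (α : Fin 3 → ℂ) (i : Fin 3) (c : ℂ) :
    dd i (fun y => c * pw α y) = fun y => (c * α i) * pw α y := by
  funext y
  rw [dd, ((pw_hasFDerivAt α y).const_mul c).fderiv]
  have : (∑ x, α x * (((if x = i then 1 else 0 : ℝ)) : ℂ)) = α i := by
    rw [Finset.sum_eq_single i]
    · simp
    · intro j _ hj; simp [hj]
    · simp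
  simp [this]
  ring

lemma pw_lap (α : Fin 3 → ℂ) (y : E3) : lap3 (pw α) y = (∑ i, α i ^ 2) * pw α y := by
  have h : pw α = fun y => 1 * pw α y := by simp
  rw [lap3_eq, Finset.sum_mul]
  refine Finset.sum_congr rfl fun i _ => ?_
  rw [h, pw_dd, pw_dd]
  ring

lemma pw_contDiff (α : Fin 3 → ℂ) : ContDiff ℝ 2 (pw α) := by
  unfold pw
  refine ContDiff.cexp ?_
  refine ContDiff.sum fun i _ => contDiff_const.mul ?_
  exact Complex.ofRealCLM.contDiff.comp (EuclideanSpace.proj i : E3 →L[ℝ] ℝ).contDiff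

def ph (v q : ℝ × ℝ) : ℂ := Complex.exp (-Complex.I * ((q.1 * v.1 + q.2 * v.2 : ℝ) : ℂ))

lemma ph_norm (v q : ℝ × ℝ) : ‖ph v q‖ = 1 := by
  rw [ph, show -Complex.I * ((q.1 * v.1 + q.2 * v.2 : ℝ) : ℂ)
    = ((-(q.1 * v.1 + q.2 * v.2) : ℝ) : ℂ) * Complex.I by push_cast; ring]
  exact Complex.norm_exp_ofReal_mul_I _

lemma ph_continuous : Continuous fun z : (ℝ × ℝ) × (ℝ × ℝ) => ph z.1 z.2 := by
  unfold ph; fun_prop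

theorem pw_rep {κ μ : ℂ} (hκ : 0 < κ.im) (hμ : 0 ≤ μ.im) {v : ℝ × ℝ}
    (hsq : μ ^ 2 = κ ^ 2 - ((v.1 ^ 2 + v.2 ^ 2 : ℝ) : ℂ)) {h : ℝ} (hh : 0 < h) (p : ℝ × ℝ) :
    cst * (ph v p * Complex.exp (Complex.I * μ * h))
      = ∫ q : ℝ × ℝ, ph v q * Mk κ h (p - q) := by
  set α : Fin 3 → ℂ := ![-Complex.I * v.1, -Complex.I * v.2, -Complex.I * μ] with hα
  have hc : Continuous (pw α) := (pw_contDiff α).continuous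
  have h0 : ∀ q : ℝ × ℝ, pw α (pt3 q.1 q.2 0) = ph v q := by
    intro q
    simp only [pw, ph, Fin.sum_univ_three, hα, pt3_apply0, pt3_apply1, pt3_apply2]
    simp
    congr 1; ring
  have h1 : pw α (pt3 p.1 p.2 (-h)) = ph v p * Complex.exp (Complex.I * μ * h) := by
    rw [ph, ← Complex.exp_add]
    simp only [pw, Fin.sum_univ_three, hα, pt3_apply0, pt3_apply1, pt3_apply2]
    simp
    congr 1; ring
  have hb : ∀ x : E3, x 2 ≤ 0 → ‖pw α x‖ ≤ 1 := by
    intro x hx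
    rw [pw, Complex.norm_exp, Real.exp_le_one_iff, Fin.sum_univ_three]
    simp [hα]
    nlinarith
  have hI : Integrable fun q : ℝ × ℝ => pw α (pt3 q.1 q.2 0) * Mk κ h (p - q) := by
    have hM : Integrable fun q : ℝ × ℝ => Mk κ h (p - q) := (Mk_integrable κ hκ hh).comp_sub_left p
    refine hM.bdd_mul (c := 1) ?_ (Eventually.of_forall fun q => ?_)
    · simp only [h0]
      exact (ph_continuous.comp (by fun_prop : Continuous fun q => (v, q))).aestronglyMeasurable
    · rw [h0, ph_norm]
  have := rep κ hc.continuousOn (pw_contDiff α).contDiffOn (fun x _ => ?_) hh p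
    (fun ε hε => err_decay κ hκ hc.continuousOn hb hε h p) hI
  · rw [h1] at this
    simpa only [h0] using this
  · rw [pw_lap, ← add_mul, Fin.sum_univ_three]
    simp only [hα]
    simp
    left
    rw [mul_pow, mul_pow, mul_pow, Complex.I_sq, hsq]
    push_cast
    ring

end Part10

section Part11

open MeasureTheory Filter Topology



def zz (κ : ℂ) (v : ℝ × ℝ) : ℂ := κ ^ 2 - ((v.1 ^ 2 + v.2 ^ 2 : ℝ) : ℂ)

/-- square root in the upper half plane -/
def mu (κ : ℂ) (v : ℝ × ℝ) : ℂ :=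
  (Real.sqrt ((‖zz κ v‖ + (zz κ v).re) / 2) : ℂ)
    + Complex.I * (Real.sqrt ((‖zz κ v‖ - (zz κ v).re) / 2) : ℂ)

lemma mu_im (κ : ℂ) (v : ℝ × ℝ) : 0 ≤ (mu κ v).im := by
  simp [mu]
  positivity

lemma mu_sq {κ : ℂ} {v : ℝ × ℝ} (h : 0 ≤ (κ ^ 2).im) : mu κ v ^ 2 = zz κ v := by
  have hz : 0 ≤ (zz κ v).im := by rw [zz, Complex.sub_im, Complex.ofReal_im]; linarith
  unfold mu
  generalize zz κ v = z at *
  have h1 : 0 ≤ (‖z‖ + z.re) / 2 := by linarith [neg_le_of_abs_le (Complex.abs_re_le_norm z)]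
  have h2 : 0 ≤ (‖z‖ - z.re) / 2 := by linarith [le_of_abs_le (Complex.abs_re_le_norm z)]
  have h3 : Real.sqrt ((‖z‖ + z.re) / 2) * Real.sqrt ((‖z‖ - z.re) / 2) = z.im / 2 := by
    rw [← Real.sqrt_mul h1]
    have : (‖z‖ + z.re) / 2 * ((‖z‖ - z.re) / 2) = (z.im / 2) ^ 2 := by
      have := Complex.sq_norm z
      rw [Complex.normSq_apply] at this
      nlinarith
    rw [this, Real.sqrt_sq (by linarith)]
  have h4 := Real.sq_sqrt h1
  have h5 := Real.sq_sqrt h2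
  generalize Real.sqrt ((‖z‖ + z.re) / 2) = a at *
  generalize Real.sqrt ((‖z‖ - z.re) / 2) = b at *
  apply Complex.ext
  · simp [sq]; nlinarith
  · simp [sq]; nlinarith

lemma mu_continuous : Continuous fun x : ℂ × (ℝ × ℝ) => mu x.1 x.2 := by
  unfold mu zz; fun_prop

lemma mu_kappa (k : ℝ) (v : ℝ × ℝ) : mu k v = kappa k v := by
  have hz : zz k v = ((k ^ 2 - v.1 ^ 2 - v.2 ^ 2 : ℝ) : ℂ) := by
    unfold zz; push_cast; ring
  unfold mu kappa
  rw [hz, Complex.norm_real, Complex.ofReal_re, Real.norm_eq_abs]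
  split_ifs with h
  · rw [abs_of_nonneg (by linarith), sub_self, zero_div, Real.sqrt_zero, ← two_mul,
      mul_div_cancel_left₀ _ two_ne_zero]
    simp
  · rw [abs_of_neg (by linarith)]
    rw [show (-(k ^ 2 - v.1 ^ 2 - v.2 ^ 2) + (k ^ 2 - v.1 ^ 2 - v.2 ^ 2)) / 2 = 0 by ring,
      show (-(k ^ 2 - v.1 ^ 2 - v.2 ^ 2) - (k ^ 2 - v.1 ^ 2 - v.2 ^ 2)) / 2
        = v.1 ^ 2 + v.2 ^ 2 - k ^ 2 by ring]
    simp

lemma mu_exp_norm (κ : ℂ) (v : ℝ × ℝ) {h : ℝ} (hh : 0 < h) :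
    ‖Complex.exp (Complex.I * mu κ v * h)‖ ≤ 1 := by
  rw [Complex.norm_exp, Real.exp_le_one_iff]
  have := mu_im κ v
  simp [Complex.mul_re, Complex.mul_im]
  positivity

open FourierTransform in
lemma BigPsi_integrable (ψ : SchwartzMap (ℝ × ℝ) ℂ) : Integrable (BigPsi ψ) := by
  let e := WithLp.prodContinuousLinearEquiv 2 ℝ ℝ ℝ
  let ψ' : SchwartzMap (WithLp 2 (ℝ × ℝ)) ℂ := SchwartzMap.compCLMOfContinuousLinearEquiv ℂ e ψ
  have mp : MeasurePreserving (WithLp.toLp 2 : ℝ × ℝ → WithLp 2 (ℝ × ℝ)) :=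
    WithLp.volume_preserving_toLp ℝ ℝ
  have me : MeasurableEmbedding (WithLp.toLp 2 : ℝ × ℝ → WithLp 2 (ℝ × ℝ)) :=
    (MeasurableEquiv.toLp 2 (ℝ × ℝ)).measurableEmbedding
  have h1 : ∀ x : ℝ × ℝ, BigPsi ψ x = (𝓕 ψ') ((2 * Real.pi)⁻¹ • WithLp.toLp 2 x) := by
    intro x
    rw [SchwartzMap.fourier_coe, Real.fourier_eq', ← mp.integral_comp me, BigPsi]
    congr 1
    funext v
    rw [smul_eq_mul, mul_comm]
    have : ψ' (WithLp.toLp 2 v) = ψ v := rfl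
    rw [this]
    congr 2
    have : inner ℝ (WithLp.toLp 2 v) ((2 * Real.pi)⁻¹ • WithLp.toLp 2 x)
        = (2 * Real.pi)⁻¹ * (x.1 * v.1 + x.2 * v.2) := by
      rw [inner_smul_right, WithLp.prod_inner_apply]
      simp
    rw [this]
    have hpi : (Real.pi : ℂ) ≠ 0 := by exact_mod_cast Real.pi_ne_zero
    push_cast
    field_simp
  have h2 : Integrable fun y : WithLp 2 (ℝ × ℝ) => (𝓕 ψ') ((2 * Real.pi)⁻¹ • y) :=
    (𝓕 ψ').integrable.comp_smul (by positivity)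
  have h3 := (mp.integrable_comp_emb me).2 h2
  refine h3.congr (Eventually.of_forall fun x => ?_)
  rw [h1]; rfl

theorem weyl_eps {κ : ℂ} (hκ : 0 < κ.im) (hκ2 : 0 ≤ (κ ^ 2).im) {h : ℝ} (hh : 0 < h)
    (ψ : SchwartzMap (ℝ × ℝ) ℂ) (p : ℝ × ℝ) :
    ∫ q : ℝ × ℝ, Mk κ h (p - q) * BigPsi ψ q
      = cst * ∫ v : ℝ × ℝ, ψ v * (ph v p * Complex.exp (Complex.I * mu κ v * h)) := by
  have hM : Integrable fun q : ℝ × ℝ => Mk κ h (p - q) := (Mk_integrable κ hκ hh).comp_sub_left p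
  have hF : Integrable (fun z : (ℝ × ℝ) × (ℝ × ℝ) => ph z.2 z.1 * (Mk κ h (p - z.1) * ψ z.2))
      (volume.prod volume) := by
    refine (hM.mul_prod ψ.integrable).bdd_mul (c := 1) ?_ (Eventually.of_forall fun z => ?_)
    · exact (ph_continuous.comp (by fun_prop : Continuous fun z : (ℝ × ℝ) × (ℝ × ℝ) =>
        (z.2, z.1))).aestronglyMeasurable
    · rw [ph_norm]
  have hsw := integral_integral_swap (f := fun q v => ph v q * (Mk κ h (p - q) * ψ v)) hF
  calc ∫ q : ℝ × ℝ, Mk κ h (p - q) * BigPsi ψ q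
      = ∫ q : ℝ × ℝ, ∫ v : ℝ × ℝ, ph v q * (Mk κ h (p - q) * ψ v) := by
        congr 1; funext q
        rw [BigPsi, ← integral_const_mul]
        congr 1; funext v
        rw [ph]; ring
    _ = ∫ v : ℝ × ℝ, ∫ q : ℝ × ℝ, ph v q * (Mk κ h (p - q) * ψ v) := hsw
    _ = ∫ v : ℝ × ℝ, cst * (ψ v * (ph v p * Complex.exp (Complex.I * mu κ v * h))) := by
        congr 1; funext v
        have := pw_rep hκ (mu_im κ v) (mu_sq hκ2) hh p
        rw [show cst * (ψ v * (ph v p * Complex.exp (Complex.I * mu κ v * h)))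
          = ψ v * (cst * (ph v p * Complex.exp (Complex.I * mu κ v * h))) by ring, this,
          ← integral_const_mul]
        congr 1; funext q
        ring
    _ = _ := integral_const_mul _ _

lemma mu_cont_v (κ : ℂ) : Continuous fun v : ℝ × ℝ => mu κ v := by
  unfold mu zz; fun_prop

lemma ph_cont_v (p : ℝ × ℝ) : Continuous fun v : ℝ × ℝ => ph v p :=
  ph_continuous.comp (continuous_id.prodMk continuous_const)

lemma mu_cont_k (v : ℝ × ℝ) : Continuous fun κ : ℂ => mu κ v := by
  unfold mu zz; fun_prop

lemma expmu_cont_v (κ : ℂ) (h : ℝ) :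
    Continuous fun v : ℝ × ℝ => Complex.exp (Complex.I * mu κ v * h) :=
  Complex.continuous_exp.comp ((continuous_const.mul (mu_cont_v κ)).mul continuous_const)

lemma expmu_cont_k (v : ℝ × ℝ) (h : ℝ) :
    Continuous fun κ : ℂ => Complex.exp (Complex.I * mu κ v * h) :=
  Complex.continuous_exp.comp ((continuous_const.mul (mu_cont_k v)).mul continuous_const)

lemma weyl_l2 {k : ℝ} {κ : ℝ → ℂ} (hκ0 : Tendsto κ (𝓝[>] 0) (𝓝 (k : ℂ))) {h : ℝ} (hh : 0 < h)
    (ψ : SchwartzMap (ℝ × ℝ) ℂ) (p : ℝ × ℝ) :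
    Tendsto (fun ε => cst * ∫ v : ℝ × ℝ, ψ v *
      (ph v p * Complex.exp (Complex.I * mu (κ ε) v * h))) (𝓝[>] 0)
      (𝓝 (cst * ∫ v : ℝ × ℝ, ψ v * (ph v p * Complex.exp (Complex.I * kappa k v * h)))) := by
  refine Tendsto.const_mul _ ?_
  refine tendsto_integral_filter_of_dominated_convergence
    (fun v => ‖ψ v‖) ?_ ?_ ψ.integrable.norm ?_
  · refine Eventually.of_forall fun ε => ?_
    exact (ψ.continuous.mul ((ph_cont_v p).mul (expmu_cont_v (κ ε) h))).aestronglyMeasurable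
  · refine Eventually.of_forall fun ε => Eventually.of_forall fun v => ?_
    rw [norm_mul, norm_mul, ph_norm, one_mul]
    exact mul_le_of_le_one_right (norm_nonneg _) (mu_exp_norm _ _ hh)
  · refine Eventually.of_forall fun v => ?_
    rw [← mu_kappa]
    exact Tendsto.const_mul _ (Tendsto.const_mul _
      (((expmu_cont_k v h).tendsto (k : ℂ)).comp hκ0))

theorem weyl {k : ℝ} (hk : 0 < k) {h : ℝ} (hh : 0 < h)
    (ψ : SchwartzMap (ℝ × ℝ) ℂ) (p : ℝ × ℝ) :
    ∫ q : ℝ × ℝ, Mk k h (p - q) * BigPsi ψ q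
      = cst * ∫ v : ℝ × ℝ, ψ v * (ph v p * Complex.exp (Complex.I * kappa k v * h)) := by
  have hΨ := BigPsi_integrable ψ
  let κ : ℝ → ℂ := fun ε => k + ε * Complex.I
  have hκc : Continuous κ := by fun_prop
  have hκ0 : Tendsto κ (𝓝[>] 0) (𝓝 k) := by
    have := hκc.tendsto 0
    simp only [κ, Complex.ofReal_zero, zero_mul, add_zero] at this
    exact this.mono_left nhdsWithin_le_nhds
  have hev : ∀ᶠ ε : ℝ in 𝓝[>] 0, 0 < ε ∧ ε ≤ 1 := by
    filter_upwards [self_mem_nhdsWithin, mem_nhdsWithin_of_mem_nhds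
      (Iic_mem_nhds (show (0:ℝ) < 1 by norm_num))] with ε h1 h2
    exact ⟨h1, h2⟩
  have him : ∀ ε, (κ ε).im = ε := fun ε => by simp [κ]
  have l1 : Tendsto (fun ε => ∫ q : ℝ × ℝ, Mk (κ ε) h (p - q) * BigPsi ψ q) (𝓝[>] 0)
      (𝓝 (∫ q : ℝ × ℝ, Mk k h (p - q) * BigPsi ψ q)) := by
    refine tendsto_integral_filter_of_dominated_convergence
      (fun q => 2 * ((k + 1) / h + 1 / h ^ 2) * ‖BigPsi ψ q‖) ?_ ?_ (hΨ.norm.const_mul _) ?_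
    · refine Eventually.of_forall fun ε => ?_
      exact (((Mk_continuous (κ ε) hh).comp (by fun_prop :
        Continuous fun q : ℝ × ℝ => p - q)).aestronglyMeasurable).mul hΨ.aestronglyMeasurable
    · filter_upwards [hev] with ε hε
      refine Eventually.of_forall fun q => ?_
      rw [norm_mul]
      gcongr
      refine (Mk_bound (κ ε) (by rw [him]; exact hε.1.le) hh _).trans ?_
      gcongr
      refine (norm_add_le _ _).trans ?_
      rw [norm_mul, Complex.norm_I, Complex.norm_real, Complex.norm_real, Real.norm_eq_abs,
        Real.norm_eq_abs, abs_of_pos hk, abs_of_pos hε.1]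
      linarith [hε.2]
    · refine Eventually.of_forall fun q => ?_
      refine Tendsto.mul_const _ ?_
      have hc : Continuous fun κ : ℂ => Mk κ h (p - q) := by unfold Mk; fun_prop
      exact (hc.tendsto _).comp hκ0
  have l2 := weyl_l2 (k := k) (κ := κ) hκ0 hh ψ p
  refine tendsto_nhds_unique l1 (l2.congr' ?_)
  filter_upwards [hev] with ε hε
  refine (weyl_eps (by rw [him]; exact hε.1) ?_ hh ψ p).symm
  simp [κ, sq]
  have := hε.1
  positivity

lemma phi_integrable {φ : ℝ × ℝ → ℂ}
    (hφm : Measurable φ) (hφb : ∃ C : ℝ, ∀ x : ℝ × ℝ, ‖φ x‖ ≤ C)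
    (hφc : HasCompactSupport φ) : Integrable φ := by
  obtain ⟨C, hC⟩ := hφb
  rw [← integrableOn_iff_integrable_of_support_subset (subset_tsupport φ)]
  exact Measure.integrableOn_of_bounded (M := C) hφc.isCompact.measure_lt_top.ne
    hφm.aestronglyMeasurable (Eventually.of_forall hC)

end Part11

open MeasureTheory Filter Topology



theorem final_step {k : ℝ} (hk : 0 < k) {h : ℝ} (hh : 0 < h) {φ W : ℝ × ℝ → ℂ}
    (hφ : Integrable φ) (hW : Continuous W)
    (hrep : ∀ p, cst * W p = ∫ q, φ q * Mk k h (p - q)) (ψ : SchwartzMap (ℝ × ℝ) ℂ) :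
    Integrable (fun p => W p * BigPsi ψ p) ∧
    ∫ p, W p * BigPsi ψ p
      = ∫ v, fourierT φ v * Complex.exp (Complex.I * kappa k v * h) * ψ v := by
  have hΨ := BigPsi_integrable ψ
  have hMb : ∀ d, ‖Mk k h d‖ ≤ 2 * (‖(k : ℂ)‖ / h + 1 / h ^ 2) :=
    Mk_bound (k : ℂ) (by simp) hh
  have hMc : Continuous (Mk k h) := Mk_continuous (k : ℂ) hh
  have hF : Integrable (fun z : (ℝ × ℝ) × (ℝ × ℝ) =>
      Mk k h (z.1 - z.2) * (BigPsi ψ z.1 * φ z.2)) (volume.prod volume) :=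
    (hΨ.mul_prod hφ).bdd_mul (c := 2 * (‖(k : ℂ)‖ / h + 1 / h ^ 2))
      (hMc.comp (continuous_fst.sub continuous_snd)).aestronglyMeasurable
      (Eventually.of_forall fun z => hMb _)
  have hWΨ : ∀ p, cst * (W p * BigPsi ψ p)
      = ∫ q, Mk k h (p - q) * (BigPsi ψ p * φ q) := by
    intro p
    rw [← mul_assoc, hrep, ← integral_mul_const]
    congr 1; funext q; ring
  have hsw := integral_integral_swap (f := fun p q => Mk k h (p - q) * (BigPsi ψ p * φ q)) hF
  have hE : ∀ v, Complex.exp (Complex.I * kappa k v * h) = Complex.exp (Complex.I * mu k v * h) :=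
    fun v => by rw [mu_kappa]
  have hG : Integrable (fun z : (ℝ × ℝ) × (ℝ × ℝ) =>
      (ph z.2 z.1 * Complex.exp (Complex.I * mu k z.2 * h)) * (φ z.1 * ψ z.2))
      (volume.prod volume) := by
    refine (hφ.mul_prod ψ.integrable).bdd_mul (c := 1) ?_ (Eventually.of_forall fun z => ?_)
    · exact ((ph_continuous.comp (continuous_snd.prodMk continuous_fst)).mul
        ((expmu_cont_v (k : ℂ) h).comp continuous_snd)).aestronglyMeasurable
    · rw [norm_mul, ph_norm, one_mul]
      exact mu_exp_norm _ _ hh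
  have hsw2 := integral_integral_swap (f := fun q v =>
      (ph v q * Complex.exp (Complex.I * mu k v * h)) * (φ q * ψ v)) hG
  constructor
  · have h1 : Integrable (fun p => cst * (W p * BigPsi ψ p)) := by
      refine hF.integral_prod_left.congr (Eventually.of_forall fun p => ?_)
      exact (hWΨ p).symm
    have h2 := h1.const_mul cst⁻¹
    refine h2.congr (Eventually.of_forall fun p => ?_)
    exact inv_mul_cancel_left₀ cst_ne _
  · apply mul_left_cancel₀ cst_ne
    calc cst * ∫ p, W p * BigPsi ψ p = ∫ p, cst * (W p * BigPsi ψ p) :=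
          (integral_const_mul _ _).symm
      _ = ∫ p, ∫ q, Mk k h (p - q) * (BigPsi ψ p * φ q) := by
          congr 1; funext p; exact hWΨ p
      _ = ∫ q, ∫ p, Mk k h (p - q) * (BigPsi ψ p * φ q) := hsw
      _ = ∫ q, cst * ∫ v, (ph v q * Complex.exp (Complex.I * mu k v * h)) * (φ q * ψ v) := by
          congr 1; funext q
          have e1 : ∫ p, Mk k h (p - q) * (BigPsi ψ p * φ q)
              = (∫ p, Mk k h (q - p) * BigPsi ψ p) * φ q := by
            rw [← integral_mul_const]
            congr 1; funext p
            rw [← Mk_even, neg_sub]; ring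
          rw [e1, weyl hk hh ψ q, mul_assoc, ← integral_mul_const]
          congr 2; funext v
          rw [hE]; ring
      _ = cst * ∫ q, ∫ v, (ph v q * Complex.exp (Complex.I * mu k v * h)) * (φ q * ψ v) :=
          integral_const_mul _ _
      _ = cst * ∫ v, ∫ q, (ph v q * Complex.exp (Complex.I * mu k v * h)) * (φ q * ψ v) := by
          rw [hsw2]
      _ = _ := by
          congr 2; funext v
          rw [hE, fourierT, ← integral_mul_const, ← integral_mul_const]
          congr 1; funext q
          rw [ph]; ring

/-- **Theorem 4.1.** Let `w` solve the Helmholtz equation in the lower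
half-space `{x₃ < 0}` with boundary data `φ` (bounded, measurable, compactly supported)
on `{x₃ = 0}` and the Sommerfeld radiation condition. Then the tempered-distribution
Fourier transform of `w(·,·,x₃)` equals `φ̂(v) e^{−iκ(v) x₃}` for every `x₃ < 0`. -/
theorem data_propagation
    (k : ℝ) (hk : 0 < k) (φ : ℝ × ℝ → ℂ)
    (hφm : Measurable φ) (hφb : ∃ C : ℝ, ∀ x : ℝ × ℝ, ‖φ x‖ ≤ C)
    (hφc : HasCompactSupport φ)
    (w : EuclideanSpace ℝ (Fin 3) → ℂ)
    (hw_cont : ContinuousOn w {x : EuclideanSpace ℝ (Fin 3) | x 2 ≤ 0})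
    (hw_smooth : ContDiffOn ℝ 2 w {x : EuclideanSpace ℝ (Fin 3) | x 2 < 0})
    (hw_helmholtz : ∀ x : EuclideanSpace ℝ (Fin 3), x 2 < 0 →
      lap3 w x + (k : ℂ) ^ 2 * w x = 0)
    (hw_bc : ∀ x₁ x₂ : ℝ, w (pt3 x₁ x₂ 0) = φ (x₁, x₂))
    (hw_rad : ∀ ε > (0 : ℝ), ∃ R : ℝ, ∀ x : EuclideanSpace ℝ (Fin 3), x 2 ≤ 0 → R ≤ ‖x‖ →
      ‖x‖ * ‖fderiv ℝ w x (‖x‖⁻¹ • x) - Complex.I * (k : ℂ) * w x‖ ≤ ε) :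
    ∀ x₃ : ℝ, x₃ < 0 → ∀ ψ : SchwartzMap (ℝ × ℝ) ℂ,
      Integrable (fun p : ℝ × ℝ => w (pt3 p.1 p.2 x₃) * BigPsi ψ p)
        (volume : Measure (ℝ × ℝ)) ∧
      ∫ p : ℝ × ℝ, w (pt3 p.1 p.2 x₃) * BigPsi ψ p =
        ∫ v : ℝ × ℝ, fourierT φ v * Complex.exp (-Complex.I * kappa k v * (x₃ : ℂ)) * ψ v := by
  intro x₃ hx₃ ψ
  obtain ⟨h, rfl⟩ : ∃ h, x₃ = -h := ⟨-x₃, by ring⟩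
  have hh : 0 < h := by linarith
  have hφ := phi_integrable hφm hφb hφc
  have hrep : ∀ p : ℝ × ℝ, cst * w (pt3 p.1 p.2 (-h)) = ∫ q, φ q * Mk k h (p - q) := by
    intro p
    have hi : Integrable fun q : ℝ × ℝ => φ q * Mk k h (p - q) :=
      hφ.mul_bdd (c := 2 * (‖(k : ℂ)‖ / h + 1 / h ^ 2))
        ((Mk_continuous (k : ℂ) hh).comp (continuous_const.sub continuous_id)).aestronglyMeasurable
        (Eventually.of_forall fun q => Mk_bound (k : ℂ) (by simp) hh _)
    have := rep (k : ℂ) hw_cont hw_smooth hw_helmholtz hh p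
      (fun ε hε => err_rad hk hw_cont hw_smooth hw_rad hε h p)
      (by simpa only [hw_bc] using hi)
    simpa only [hw_bc] using this
  have hWc : Continuous fun p : ℝ × ℝ => w (pt3 p.1 p.2 (-h)) := by
    refine hw_cont.comp_continuous ?_ ?_
    · exact continuous_pt3.comp (by fun_prop : Continuous fun p : ℝ × ℝ => (p.1, p.2, -h))
    · intro p
      simp [pt3]; exact hh.le
  have := final_step hk hh hφ hWc hrep ψ
  refine ⟨this.1, this.2.trans ?_⟩
  congr 1; funext v
  congr 3
  push_cast; ring

end
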